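/- Let P ⊆ A be a Gorenstein subring of a finitely generated normal algebra A over a field, with A a finite P-module, and suppose A is quasi-Gorenstein with respect to P, i.e. Hom_P(A,P) ≅ A as A-modules. Then for every prime ideal Q of A, the localization A_Q is Cohen-Macaulay if and only if A_Q is Gorenstein; in other words, the Cohen-Macaulay locus and the Gorenstein locus of A coincide. -/

import Mathlib

open scoped Classical

namespace QGor

/-- A local ring is Cohen-Macaulay: it admits a regular sequence in the maximal
ideal whose length equals the Krull dimension. -/
def IsCMLocalRing (B : Type*) [CommRing B] [IsLocalRing B] : Prop :=
  ∃ rs : List B, (∀ x ∈ rs, x ∈ IsLocalRing.maximalIdeal B) ∧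
    RingTheory.Sequence.IsRegular B rs ∧ (rs.length : WithBot (WithTop ℕ)) = ringKrullDim B

/-- A local ring is Gorenstein: it is Cohen-Macaulay and the artinian quotient by a maximal
regular sequence is self-injective. -/
def IsGorensteinLocalRing (B : Type*) [CommRing B] [IsLocalRing B] : Prop :=
  ∃ rs : List B, (∀ x ∈ rs, x ∈ IsLocalRing.maximalIdeal B) ∧
    RingTheory.Sequence.IsRegular B rs ∧ (rs.length : WithBot (WithTop ℕ)) = ringKrullDim B ∧
    Module.Injective (B ⧸ Ideal.span {x | x ∈ rs}) (B ⧸ Ideal.span {x | x ∈ rs})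

set_option linter.unusedSectionVars false
set_option linter.style.haveILetI false

section LocalAlg

variable {S : Type*} [CommRing S]

/-- `w` is a nonzerodivisor modulo `J`. -/
def RegMod (w : S) (J : Ideal S) : Prop := ∀ r, w * r ∈ J → r ∈ J

/-- `xs` is a weakly regular sequence modulo `J`. -/
def RegSeq : Ideal S → List S → Prop
  | _, [] => True
  | J, x :: xs => RegMod x J ∧ RegSeq (J ⊔ Ideal.span {x}) xs

/-- the depth of `S / J` is at least `k`. -/
def Dep [IsLocalRing S] : ℕ → Ideal S → Prop
  | 0, _ => True
  | k + 1, J => ∃ w ∈ IsLocalRing.maximalIdeal S, RegMod w J ∧ Dep k (J ⊔ Ideal.span {w})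

/-- no socle modulo `J`. -/
def NoSoc [IsLocalRing S] (J : Ideal S) : Prop :=
  ∀ u, (∀ z ∈ IsLocalRing.maximalIdeal S, z * u ∈ J) → u ∈ J

/-- the socle modulo `J` is at most one dimensional -/
def SocS [IsLocalRing S] (J : Ideal S) : Prop :=
  ∀ u v, (∀ z ∈ IsLocalRing.maximalIdeal S, z * u ∈ J) →
    (∀ z ∈ IsLocalRing.maximalIdeal S, z * v ∈ J) → u ∉ J → ∃ c, v - c * u ∈ J

theorem mem_sup_span {J : Ideal S} {x r : S} :
    r ∈ J ⊔ Ideal.span {x} ↔ ∃ s, r - x * s ∈ J := by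
  rw [Submodule.mem_sup]
  constructor
  · rintro ⟨y, hy, z, hz, rfl⟩
    obtain ⟨s, rfl⟩ := Ideal.mem_span_singleton'.1 hz
    exact ⟨s, by simpa [mul_comm] using hy⟩
  · rintro ⟨s, hs⟩
    exact ⟨_, hs, x * s, Ideal.mul_mem_right _ _ (Ideal.mem_span_singleton_self x), by ring⟩

theorem RegMod.pow {w : S} {J : Ideal S} (h : RegMod w J) (k : ℕ) : RegMod (w ^ k) J := by
  induction k with
  | zero => intro r hr; simpa using hr
  | succ k ih =>
    intro r hr
    apply h
    apply ih
    rwa [← mul_assoc, ← pow_succ]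

theorem avoid_coset (s : Finset (Ideal S)) (hs : ∀ p ∈ s, p.IsPrime) (x : S) (I : Ideal S)
    (h : ∀ p ∈ s, x ∈ p → ¬ I ≤ p) : ∃ i ∈ I, ∀ p ∈ s, x + i ∉ p := by
  induction' hn : s.card with n ih generalizing s
  · rw [Finset.card_eq_zero] at hn
    subst hn
    exact ⟨0, I.zero_mem, by simp⟩
  · have hne : s.Nonempty := by
      rw [← Finset.card_pos]; omega
    obtain ⟨p, hps, hpmin⟩ : ∃ p ∈ s, ∀ q ∈ s, q ≤ p → p ≤ q := by
      obtain ⟨p, hp⟩ := s.exists_minimal hne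
      exact ⟨p, hp.1, fun q hq hqp => hp.2 hq hqp⟩
    obtain ⟨i, hi, hi'⟩ := ih (s.erase p) (fun q hq => hs q (Finset.mem_of_mem_erase hq))
      (fun q hq => h q (Finset.mem_of_mem_erase hq)) (by rw [Finset.card_erase_of_mem hps]; omega)
    by_cases hxi : x + i ∈ p
    · have hI : ¬ I ≤ p := by
        intro hI
        have : x ∈ p := by
          have := p.sub_mem hxi (hI hi)
          simpa using this
        exact h p hps this hI
      have hpp := hs p hps
      have : ¬ I * ∏ q ∈ s.erase p, q ≤ p := by
        intro hle
        rcases hpp.mul_le.1 hle with h1 | h1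
        · exact hI h1
        · obtain ⟨q, hq, hqp⟩ := (hpp.prod_le).1 h1
          have hq' := Finset.mem_erase.1 hq
          exact hq'.1 (le_antisymm hqp (hpmin q hq'.2 hqp))
      obtain ⟨j, hj, hjp⟩ := SetLike.not_le_iff_exists.1 this
      have hjI : j ∈ I := (Ideal.mul_le_left : I * _ ≤ I) hj
      refine ⟨i + j, I.add_mem hi hjI, ?_⟩
      intro q hq
      by_cases hqp : q = p
      · subst hqp
        intro hmem
        apply hjp
        have := q.sub_mem hmem hxi
        have e : x + (i + j) - (x + i) = j := by ring
        rwa [e] at this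
      · have hq' : q ∈ s.erase p := Finset.mem_erase.2 ⟨hqp, hq⟩
        have hle1 : ∏ q ∈ s.erase p, q ≤ (s.erase p).inf (fun q => q) := Ideal.prod_le_inf
        have hle2 : (s.erase p).inf (fun q => q) ≤ q := Finset.inf_le hq'
        have hle3 : I * ∏ q ∈ s.erase p, q ≤ ∏ q ∈ s.erase p, q := Ideal.mul_le_right
        have hjq : j ∈ q := hle2 (hle1 (hle3 hj))
        intro hmem
        apply hi' q hq'
        have := q.sub_mem hmem hjq
        have e : x + (i + j) - j = x + i := by ring
        rwa [e] at this
    · refine ⟨i, hi, fun q hq => ?_⟩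
      by_cases hqp : q = p
      · subst hqp; exact hxi
      · exact hi' q (Finset.mem_erase.2 ⟨hqp, hq⟩)

theorem regMod_iff_isSMulRegular {w : S} {J : Ideal S} : RegMod w J ↔ IsSMulRegular (S ⧸ J) w :=
  (isSMulRegular_quotient_iff_mem_of_smul_mem J w).symm

theorem exists_primes [IsNoetherianRing S] (J : Ideal S) : ∃ s : Finset (Ideal S),
    (∀ p ∈ s, p.IsPrime) ∧ (∀ w, (∀ p ∈ s, w ∉ p) → RegMod w J) ∧
    ∀ p ∈ s, ∃ u, u ∉ J ∧ ∀ z ∈ p, z * u ∈ J := by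
  refine ⟨(associatedPrimes.finite S (S ⧸ J)).toFinset, ?_, ?_, ?_⟩
  · intro p hp
    exact IsAssociatedPrime.isPrime ((Set.Finite.mem_toFinset _).1 hp)
  · intro w hw
    rw [regMod_iff_isSMulRegular]
    by_contra hcon
    have : w ∈ ({ r : S | IsSMulRegular (S ⧸ J) r }ᶜ : Set S) := hcon
    rw [← biUnion_associatedPrimes_eq_compl_regular] at this
    simp only [Set.mem_iUnion] at this
    obtain ⟨p, hp, hwp⟩ := this
    exact hw p ((Set.Finite.mem_toFinset _).2 hp) hwp
  · intro p hp
    have hp' : IsAssociatedPrime p (S ⧸ J) := (Set.Finite.mem_toFinset _).1 hp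
    obtain ⟨hpr, x, hx⟩ := isAssociatedPrime_iff_exists_injective_linearMap p (S ⧸ J) |>.1 hp'
    obtain ⟨u, hu⟩ := Ideal.Quotient.mk_surjective (x (Ideal.Quotient.mk p 1))
    refine ⟨u, ?_, ?_⟩
    · intro huJ
      rw [Ideal.Quotient.eq_zero_iff_mem.2 huJ] at hu
      have h0 := hx (hu.symm.trans (map_zero x).symm)
      exact hpr.ne_top ((Ideal.eq_top_iff_one p).2 (Ideal.Quotient.eq_zero_iff_mem.1 h0))
    · intro z hz
      rw [← Ideal.Quotient.eq_zero_iff_mem, map_mul, hu]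
      have : (Ideal.Quotient.mk J z) * x (Ideal.Quotient.mk p 1) = x (z • Ideal.Quotient.mk p 1) := by
        rw [map_smul]; rfl
      rw [this]
      have : z • Ideal.Quotient.mk p (1 : S) = 0 := by
        have : z • Ideal.Quotient.mk p (1 : S) = Ideal.Quotient.mk p (z * 1) := rfl
        rw [this, mul_one]
        exact Ideal.Quotient.eq_zero_iff_mem.2 hz
      rw [this, map_zero]

variable [IsLocalRing S] [IsNoetherianRing S]

open IsLocalRing

theorem swap {J : Ideal S} {x y : S} (hx : x ∈ maximalIdeal S)
    (h1 : RegMod x J) (h2 : RegMod y (J ⊔ Ideal.span {x})) :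
    RegMod y J ∧ RegMod x (J ⊔ Ideal.span {y}) := by
  constructor
  · let K : Ideal S := Submodule.comap (LinearMap.mulLeft S y) J
    have hK : K ≤ J ⊔ (Ideal.span {x}) • K := by
      intro r hr
      have hr' : y * r ∈ J := hr
      obtain ⟨s, hs⟩ := mem_sup_span.1 (h2 r (Ideal.mem_sup_left hr'))
      have : s ∈ K := by
        apply h1
        have : x * (y * s) = y * r - y * (r - x * s) := by ring
        change x * (y * s) ∈ J
        rw [this]
        exact J.sub_mem hr' (J.mul_mem_left _ hs)
      have e : r = (r - x * s) + x * s := by ring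
      rw [e]
      exact Submodule.add_mem_sup hs
        (Submodule.smul_mem_smul (Ideal.mem_span_singleton_self x) this)
    have := Submodule.le_of_le_smul_of_le_jacobson_bot (I := Ideal.span {x})
      (IsNoetherian.noetherian K) (by
        rw [Ideal.span_singleton_le_iff_mem]
        exact IsLocalRing.maximalIdeal_le_jacobson _ hx) hK
    intro r hr
    exact this hr
  · intro r hr
    obtain ⟨s, hs⟩ := mem_sup_span.1 hr
    have : s ∈ J ⊔ Ideal.span {x} := by
      apply h2
      refine mem_sup_span.2 ⟨r, ?_⟩
      have := J.neg_mem hs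
      rwa [neg_sub] at this
    obtain ⟨s', hs'⟩ := mem_sup_span.1 this
    refine mem_sup_span.2 ⟨s', h1 _ ?_⟩
    have : x * (r - y * s') = (x * r - y * s) + y * (s - x * s') := by ring
    rw [this]
    exact J.add_mem hs (J.mul_mem_left _ hs')

theorem noSoc_exchange {J : Ideal S} {a b : S} (hb : b ∈ maximalIdeal S)
    (h1 : RegMod a J) (h2 : RegMod b J) (h3 : NoSoc (J ⊔ Ideal.span {b})) :
    NoSoc (J ⊔ Ideal.span {a}) := by
  intro u hu
  obtain ⟨v, hv⟩ := mem_sup_span.1 (hu b hb)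
  have : v ∈ J ⊔ Ideal.span {b} := by
    apply h3
    intro z hz
    obtain ⟨w, hw⟩ := mem_sup_span.1 (hu z hz)
    refine mem_sup_span.2 ⟨w, h1 _ ?_⟩
    have : a * (z * v - b * w) = b * (z * u - a * w) - z * (b * u - a * v) := by ring
    rw [this]
    exact J.sub_mem (J.mul_mem_left _ hw) (J.mul_mem_left _ hv)
  obtain ⟨v', hv'⟩ := mem_sup_span.1 this
  refine mem_sup_span.2 ⟨v', h2 _ ?_⟩
  have : b * (u - a * v') = (b * u - a * v) + a * (v - b * v') := by ring
  rw [this]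
  exact J.add_mem hv (J.mul_mem_left _ hv')

theorem Dep.noSoc {J : Ideal S} {k : ℕ} (h : Dep (k + 1) J) : NoSoc J := by
  obtain ⟨w, hw, hr, -⟩ := h
  intro u hu
  exact hr u (hu w hw)

theorem exists_reg2 {J K : Ideal S} (hJ : NoSoc J) (hK : NoSoc K) :
    ∃ w ∈ maximalIdeal S, RegMod w J ∧ RegMod w K := by
  obtain ⟨s, hs1, hs2, hs3⟩ := exists_primes J
  obtain ⟨t, ht1, ht2, ht3⟩ := exists_primes K
  obtain ⟨i, hi, hi'⟩ := avoid_coset (s ∪ t)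
    (fun p hp => (Finset.mem_union.1 hp).elim (hs1 p) (ht1 p)) 0 (maximalIdeal S) (by
      intro p hp _ hle
      rcases Finset.mem_union.1 hp with hp | hp
      · obtain ⟨u, hu, hu'⟩ := hs3 p hp
        exact hu (hJ u fun z hz => hu' z (hle hz))
      · obtain ⟨u, hu, hu'⟩ := ht3 p hp
        exact hu (hK u fun z hz => hu' z (hle hz)))
  simp only [zero_add] at hi'
  exact ⟨i, hi, hs2 i fun p hp => hi' p (Finset.mem_union_left _ hp),
    ht2 i fun p hp => hi' p (Finset.mem_union_right _ hp)⟩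

theorem Dep.quot {t : ℕ} : ∀ {J : Ideal S} {z : S}, Dep (t + 1) J → z ∈ maximalIdeal S →
    RegMod z J → Dep t (J ⊔ Ideal.span {z}) := by
  induction t with
  | zero => intros; trivial
  | succ k ih =>
    intro J z hd hz hzr
    obtain ⟨y, hy, hyr, hyd⟩ := hd
    have n1 : NoSoc (J ⊔ Ideal.span {y}) := hyd.noSoc
    have n2 : NoSoc (J ⊔ Ideal.span {z}) := noSoc_exchange hy hzr hyr n1
    obtain ⟨w, hw, hw1, hw2⟩ := exists_reg2 n1 n2
    have d1 := ih hyd hw hw1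
    have s1 := swap hy hyr hw1
    have s2 := swap hz hzr hw2
    have d2 : Dep (k + 1) (J ⊔ Ideal.span {w}) := ⟨y, hy, s1.2, by
      rwa [sup_right_comm]⟩
    have d3 := ih d2 hz s2.2
    exact ⟨w, hw, hw2, by rwa [sup_right_comm]⟩

theorem RegMod.congr {J : Ideal S} {x y : S} (h : RegMod x J) (hxy : x - y ∈ J) : RegMod y J := by
  intro r hr
  apply h
  have : x * r = (x - y) * r + y * r := by ring
  rw [this]
  exact J.add_mem (J.mul_mem_right _ hxy) hr

theorem regSeq_cons_iff {z : S} (hz : z ∈ maximalIdeal S) : ∀ {rest : List S} {J : Ideal S},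
    (∀ x ∈ rest, x ∈ maximalIdeal S) →
    (RegSeq J (z :: rest) ↔ RegSeq J rest ∧ RegMod z (J ⊔ Ideal.ofList rest)) := by
  intro rest
  induction rest with
  | nil => intro J _; simp [RegSeq]
  | cons x rest ih =>
    intro J hm
    have hx : x ∈ maximalIdeal S := hm x (by simp)
    have hm' : ∀ y ∈ rest, y ∈ maximalIdeal S := fun y hy => hm y (by simp [hy])
    have ih' := ih (J := J ⊔ Ideal.span {x}) hm'
    rw [Ideal.ofList_cons, ← sup_assoc]
    simp only [RegSeq] at ih' ⊢
    constructor
    · rintro ⟨h1, h2, h3⟩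
      have s := swap hz h1 h2
      rw [sup_right_comm] at h3
      have := ih'.1 ⟨s.2, h3⟩
      exact ⟨⟨s.1, this.1⟩, this.2⟩
    · rintro ⟨⟨h1, h2⟩, h3⟩
      have := ih'.2 ⟨h2, h3⟩
      have s := swap hx h1 this.1
      refine ⟨s.1, s.2, ?_⟩
      rw [sup_right_comm]
      exact this.2

theorem regSeq_of_dep {N : ℕ} : ∀ {xs : List S} {J : Ideal S},
    (∀ x ∈ xs, x ∈ maximalIdeal S) → Dep xs.length J →
    maximalIdeal S ^ N ≤ J ⊔ Ideal.ofList xs → RegSeq J xs := by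
  intro xs
  induction xs with
  | nil => intros; trivial
  | cons x rest ih =>
    intro J hm hd hN
    have hx : x ∈ maximalIdeal S := hm x (by simp)
    have hm' : ∀ y ∈ rest, y ∈ maximalIdeal S := fun y hy => hm y (by simp [hy])
    have hrest : Ideal.ofList rest ≤ maximalIdeal S := Ideal.span_le.2 hm'
    rw [Ideal.ofList_cons, ← sup_assoc] at hN
    obtain ⟨w, hw, hwr, -⟩ := id hd
    obtain ⟨s, hs1, hs2, hs3⟩ := exists_primes J
    obtain ⟨i, hi, hi'⟩ := avoid_coset s hs1 x (Ideal.ofList rest) (by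
      intro p hp hxp hle
      obtain ⟨u, hu, hu'⟩ := hs3 p hp
      apply hu
      apply hwr.pow N
      have hwN := hN (Ideal.pow_mem_pow hw N)
      obtain ⟨a, ha, b, hb, hab⟩ := Submodule.mem_sup.1 hwN
      obtain ⟨c, hc⟩ := mem_sup_span.1 ha
      have : w ^ N * u = (a - x * c) * u + c * (x * u) + b * u := by rw [← hab]; ring
      rw [this]
      exact J.add_mem (J.add_mem (J.mul_mem_right _ hc) (J.mul_mem_left _ (hu' x hxp)))
        (hu' b (hle hb)))
    have hz : x + i ∈ maximalIdeal S := Ideal.add_mem _ hx (hrest hi)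
    have hzr := hs2 _ hi'
    have hd' : Dep rest.length (J ⊔ Ideal.span {x + i}) := Dep.quot hd hz hzr
    have hi2 : RegSeq (J ⊔ Ideal.span {x + i}) rest := by
      apply ih hm' hd'
      refine hN.trans ?_
      refine sup_le (sup_le (le_sup_left.trans le_sup_left) ?_) le_sup_right
      rw [Ideal.span_singleton_le_iff_mem]
      have e : (x + i) - i ∈ J ⊔ Ideal.span {x + i} ⊔ Ideal.ofList rest :=
        Ideal.sub_mem _ (Ideal.mem_sup_left (Ideal.mem_sup_right
          (Ideal.mem_span_singleton_self _))) (Ideal.mem_sup_right hi)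
      rwa [add_sub_cancel_right] at e
    have h3 := (regSeq_cons_iff hz hm').1 (show RegSeq J ((x + i) :: rest) from ⟨hzr, hi2⟩)
    refine (regSeq_cons_iff hx hm').2 ⟨h3.1, h3.2.congr ?_⟩
    have : x + i - x = i := by ring
    rw [this]
    exact Ideal.mem_sup_right hi

/-! ### powers -/

theorem pow_mem_max {xs : List S} (k : ℕ) (h : ∀ x ∈ xs, x ∈ maximalIdeal S) :
    ∀ x ∈ xs.map (· ^ (k + 1)), x ∈ maximalIdeal S := by
  intro x hx
  obtain ⟨y, hy, rfl⟩ := List.mem_map.1 hx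
  exact Ideal.pow_mem_of_mem _ (h y hy) _ (by omega)

theorem regSeq_pow (k : ℕ) : ∀ {xs : List S} {J : Ideal S},
    (∀ x ∈ xs, x ∈ maximalIdeal S) → RegSeq J xs → RegSeq J (xs.map (· ^ (k + 1))) := by
  intro xs
  induction xs with
  | nil => intros; trivial
  | cons x rest ih =>
    intro J hm h
    have hx : x ∈ maximalIdeal S := hm x (by simp)
    have hm' : ∀ y ∈ rest, y ∈ maximalIdeal S := fun y hy => hm y (by simp [hy])
    have h2 := (regSeq_cons_iff hx hm').1 h
    have hx' : x ^ (k + 1) ∈ maximalIdeal S := Ideal.pow_mem_of_mem _ hx _ (by omega)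
    have h3 := (regSeq_cons_iff hx' hm').2 ⟨h2.1, h2.2.pow _⟩
    exact ⟨h3.1, ih hm' h3.2⟩

theorem regMod_pow {x : S} {rest : List S} {J : Ideal S} (k : ℕ) (hx : x ∈ maximalIdeal S)
    (hm' : ∀ y ∈ rest, y ∈ maximalIdeal S) (h : RegSeq J (x :: rest)) :
    RegMod x (J ⊔ Ideal.ofList (rest.map (· ^ (k + 1)))) :=
  ((regSeq_cons_iff hx (pow_mem_max k hm')).1
    (show RegSeq J (x :: rest.map (· ^ (k + 1))) from ⟨h.1, regSeq_pow k hm' h.2⟩)).2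

theorem colon_pow (k : ℕ) : ∀ {xs : List S} {J : Ideal S},
    (∀ x ∈ xs, x ∈ maximalIdeal S) → RegSeq J xs → ∀ r,
    xs.prod ^ k * r ∈ J ⊔ Ideal.ofList (xs.map (· ^ (k + 1))) → r ∈ J ⊔ Ideal.ofList xs := by
  intro xs
  induction xs with
  | nil => intro J _ _ r hr; simpa using hr
  | cons x rest ih =>
    intro J hm h r hr
    have hx : x ∈ maximalIdeal S := hm x (by simp)
    have hm' : ∀ y ∈ rest, y ∈ maximalIdeal S := fun y hy => hm y (by simp [hy])
    rw [Ideal.ofList_cons, ← sup_assoc]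
    apply ih hm' h.2
    rw [List.map_cons, Ideal.ofList_cons, ← sup_assoc, sup_right_comm, List.prod_cons] at hr
    obtain ⟨s, hs⟩ := mem_sup_span.1 hr
    rw [sup_right_comm]
    refine mem_sup_span.2 ⟨s, (regMod_pow k hx hm' h).pow k _ ?_⟩
    have : x ^ k * (rest.prod ^ k * r - x * s) = (x * rest.prod) ^ k * r - x ^ (k + 1) * s := by
      rw [mul_pow]; ring
    rwa [this]

theorem SocS.pow_one {x : S} {J : Ideal S} (k : ℕ) (hx : x ∈ maximalIdeal S) (h : RegMod x J)
    (hs : SocS (J ⊔ Ideal.span {x})) : SocS (J ⊔ Ideal.span {x ^ (k + 1)}) := by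
  have key : ∀ u, (∀ z ∈ maximalIdeal S, z * u ∈ J ⊔ Ideal.span {x ^ (k + 1)}) →
      ∃ s, u - x ^ k * s ∈ J ∧ ∀ z ∈ maximalIdeal S, z * s ∈ J ⊔ Ideal.span {x} := by
    intro u hu
    obtain ⟨s, hs⟩ := mem_sup_span.1 (hu x hx)
    have h1 : u - x ^ k * s ∈ J := by
      apply h
      have : x * (u - x ^ k * s) = x * u - x ^ (k + 1) * s := by ring
      rwa [this]
    refine ⟨s, h1, fun z hz => ?_⟩
    obtain ⟨w, hw⟩ := mem_sup_span.1 (hu z hz)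
    refine mem_sup_span.2 ⟨w, h.pow k _ ?_⟩
    have : x ^ k * (z * s - x * w) = (z * u - x ^ (k + 1) * w) - z * (u - x ^ k * s) := by ring
    rw [this]
    exact J.sub_mem hw (J.mul_mem_left _ h1)
  intro u v hu hv hnu
  obtain ⟨s, hs1, hs2⟩ := key u hu
  obtain ⟨t, ht1, ht2⟩ := key v hv
  have hsn : s ∉ J ⊔ Ideal.span {x} := by
    intro hmem
    apply hnu
    obtain ⟨w, hw⟩ := mem_sup_span.1 hmem
    refine mem_sup_span.2 ⟨w, ?_⟩
    have : u - x ^ (k + 1) * w = (u - x ^ k * s) + x ^ k * (s - x * w) := by ring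
    rw [this]
    exact J.add_mem hs1 (J.mul_mem_left _ hw)
  obtain ⟨c, hc⟩ := hs s t hs2 ht2 hsn
  obtain ⟨w, hw⟩ := mem_sup_span.1 hc
  refine ⟨c, mem_sup_span.2 ⟨w, ?_⟩⟩
  have : v - c * u - x ^ (k + 1) * w =
      (v - x ^ k * t) - c * (u - x ^ k * s) + x ^ k * (t - c * s - x * w) := by ring
  rw [this]
  exact J.add_mem (J.sub_mem ht1 (J.mul_mem_left _ hs1)) (J.mul_mem_left _ hw)

theorem SocS.pow_list (k : ℕ) : ∀ {xs : List S} {J : Ideal S},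
    (∀ x ∈ xs, x ∈ maximalIdeal S) → RegSeq J xs → SocS (J ⊔ Ideal.ofList xs) →
    SocS (J ⊔ Ideal.ofList (xs.map (· ^ (k + 1)))) := by
  intro xs
  induction xs with
  | nil => intro J _ _ h; simpa using h
  | cons x rest ih =>
    intro J hm h hs
    have hx : x ∈ maximalIdeal S := hm x (by simp)
    have hm' : ∀ y ∈ rest, y ∈ maximalIdeal S := fun y hy => hm y (by simp [hy])
    rw [Ideal.ofList_cons, ← sup_assoc] at hs
    have := ih hm' h.2 hs
    rw [List.map_cons, Ideal.ofList_cons, ← sup_assoc, sup_right_comm]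
    rw [sup_right_comm] at this
    exact SocS.pow_one k hx (regMod_pow k hx hm' h) this

end LocalAlg

section Inj

open IsLocalRing

variable {T : Type*} [CommRing T] [IsLocalRing T]

theorem length_hom_simple_le (soc : ∀ u v : T, (∀ z ∈ maximalIdeal T, z * u = 0) →
    (∀ z ∈ maximalIdeal T, z * v = 0) → u ≠ 0 → ∃ c, v = c * u)
    (M : Type*) [AddCommGroup M] [Module T M] [IsSimpleModule T M] :
    Module.length T (M →ₗ[T] T) ≤ 1 := by
  rcases subsingleton_or_nontrivial (M →ₗ[T] T) with h | h
  · rw [Module.length_eq_zero]; exact zero_le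
  · refine (Module.length_eq_one_iff.2 ?_).le
    rw [isSimpleModule_iff_toSpanSingleton_surjective]
    refine ⟨h, fun f hf g => ?_⟩
    have hM : IsSimpleModule T M := inferInstance
    obtain ⟨_, hsurj⟩ := isSimpleModule_iff_toSpanSingleton_surjective.1 hM
    obtain ⟨m, hm⟩ := exists_ne (0 : M)
    have hgen := hsurj m hm
    have hkill : ∀ z ∈ maximalIdeal T, z • m = 0 := by
      intro z hz
      by_contra hne
      obtain ⟨c, hc⟩ := hsurj _ hne m
      simp only [LinearMap.toSpanSingleton_apply] at hc
      have h1 : (1 - c * z) • m = 0 := by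
        rw [sub_smul, one_smul, mul_smul, hc, sub_self]
      have hu : IsUnit (1 - c * z) := by
        by_contra hnu
        have h2 : (1 - c * z) ∈ maximalIdeal T := hnu
        have h3 := Ideal.add_mem _ h2 (Ideal.mul_mem_left _ c hz)
        rw [sub_add_cancel] at h3
        exact (Ideal.ne_top_iff_one _).1 (Ideal.IsPrime.ne_top inferInstance) h3
      exact hm ((hu.smul_eq_zero).1 h1)
    have hfm : f m ≠ 0 := by
      intro h0
      apply hf
      ext x
      obtain ⟨c, rfl⟩ := hgen x
      simp [h0]
    obtain ⟨c, hc⟩ := soc (f m) (g m)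
      (fun z hz => by rw [← smul_eq_mul, ← map_smul, hkill z hz, map_zero])
      (fun z hz => by rw [← smul_eq_mul, ← map_smul, hkill z hz, map_zero]) hfm
    refine ⟨c, ?_⟩
    ext x
    obtain ⟨d, rfl⟩ := hgen x
    simp [hc]

theorem length_hom_split {M : Type*} [AddCommGroup M] [Module T M] (N : Submodule T M) :
    Module.length T (M →ₗ[T] T) = Module.length T ((M ⧸ N) →ₗ[T] T) +
      Module.length T (LinearMap.range (LinearMap.lcomp T T N.subtype)) := by
  refine Module.length_eq_add_of_exact (LinearMap.lcomp T T N.mkQ)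
    (LinearMap.rangeRestrict (LinearMap.lcomp T T N.subtype)) ?_ ?_ ?_
  · intro f g hfg
    ext x
    exact LinearMap.congr_fun hfg x
  · exact LinearMap.surjective_rangeRestrict _
  · intro f
    constructor
    · intro hf
      have hf' : f ∘ₗ N.subtype = 0 := by
        have := congrArg Subtype.val hf
        exact this
      refine ⟨N.liftQ f ?_, ?_⟩
      · intro x hx
        exact LinearMap.congr_fun hf' ⟨x, hx⟩
      · ext x; rfl
    · rintro ⟨g, rfl⟩
      apply Subtype.ext
      ext x
      have : N.mkQ x = 0 := by simp
      change g (N.mkQ x) = 0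
      rw [this, map_zero]

theorem length_hom_le (soc : ∀ u v : T, (∀ z ∈ maximalIdeal T, z * u = 0) →
    (∀ z ∈ maximalIdeal T, z * v = 0) → u ≠ 0 → ∃ c, v = c * u)
    (M : Type*) [AddCommGroup M] [Module T M] (h : IsFiniteLength T M) :
    Module.length T (M →ₗ[T] T) ≤ Module.length T M := by
  induction h with
  | of_subsingleton => rw [Module.length_eq_zero]; exact zero_le
  | @of_simple_quotient M _ _ N _ hN ih =>
    have e : Module.length T M = Module.length T N + Module.length T (M ⧸ N) :=
      Module.length_eq_add_of_exact N.subtype N.mkQ N.injective_subtype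
        N.mkQ_surjective (LinearMap.exact_subtype_mkQ N)
    rw [length_hom_split N, e, add_comm, Module.length_eq_one T (M ⧸ N)]
    exact add_le_add ((Module.length_le_of_injective
      (LinearMap.range (LinearMap.lcomp T T N.subtype)).subtype
      (Submodule.injective_subtype _)).trans ih) (length_hom_simple_le soc _)

theorem injective_of_soc [IsArtinianRing T] (soc : ∀ u v : T, (∀ z ∈ maximalIdeal T, z * u = 0) →
    (∀ z ∈ maximalIdeal T, z * v = 0) → u ≠ 0 → ∃ c, v = c * u) : Module.Injective T T := by
  apply Module.Baer.injective
  intro I g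
  have fl : ∀ (M : Type _) [AddCommGroup M] [Module T M] [Module.Finite T M], IsFiniteLength T M := by
    intro M _ _ _
    exact isFiniteLength_iff_isNoetherian_isArtinian.2 ⟨inferInstance, inferInstance⟩
  have e1 := length_hom_split (T := T) (M := T) I
  have e2 := Module.length_eq_add_of_exact I.subtype I.mkQ I.injective_subtype
      I.mkQ_surjective (LinearMap.exact_subtype_mkQ I)
  rw [(LinearMap.ringLmapEquivSelf T T T).length_eq, e2] at e1
  have e3 := length_hom_le soc (T ⧸ I) (fl _)
  have e4 := length_hom_le soc I (fl _)
  have n1 : Module.length T I ≠ ⊤ := Module.length_ne_top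
  have n2 : Module.length T (T ⧸ I) ≠ ⊤ := Module.length_ne_top
  have htop : LinearMap.range (LinearMap.lcomp T T (Submodule.subtype I)) = ⊤ := by
    have fH : IsFiniteLength T (I →ₗ[T] T) :=
      Module.length_ne_top_iff.1 (ne_top_of_le_ne_top n1 e4)
    obtain ⟨h1, h2⟩ := isFiniteLength_iff_isNoetherian_isArtinian.1 fH
    by_contra hne
    have hlt := Submodule.length_lt hne
    have hlt' := hlt.trans_le e4
    have : Module.length T I + Module.length T (T ⧸ I) <
        Module.length T I + Module.length T (T ⧸ I) := by
      nth_rewrite 1 [e1]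
      rw [add_comm (Module.length T I)]
      exact (add_le_add_left e3 _).trans_lt ((ENat.add_lt_add_iff_left n2).2 hlt')
    exact lt_irrefl _ this
  obtain ⟨g', hg'⟩ := (htop ▸ Submodule.mem_top : g ∈ LinearMap.range (LinearMap.lcomp T T (Submodule.subtype I)))
  exact ⟨g', fun x hx => LinearMap.congr_fun hg' ⟨x, hx⟩⟩

end Inj

section Bridge

open IsLocalRing

variable {S : Type*} [CommRing S] [IsLocalRing S]

theorem mk_mem_max {J : Ideal S} (hJ : J ≠ ⊤) [IsLocalRing (S ⧸ J)] (z : S) :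
    Ideal.Quotient.mk J z ∈ maximalIdeal (S ⧸ J) ↔ z ∈ maximalIdeal S := by
  constructor
  · intro h hz
    exact h (hz.map _)
  · intro hz hu
    obtain ⟨w, hw⟩ := hu.exists_right_inv
    obtain ⟨w, rfl⟩ := Ideal.Quotient.mk_surjective w
    rw [← map_mul, ← map_one (Ideal.Quotient.mk J)] at hw
    have h1 := le_maximalIdeal hJ (Ideal.Quotient.eq.1 hw)
    have h2 := Ideal.sub_mem _ (Ideal.mul_mem_right w _ hz) h1
    rw [sub_sub_cancel] at h2
    exact (Ideal.ne_top_iff_one _).1 (Ideal.IsPrime.ne_top inferInstance) h2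

theorem isArtinian_quot [IsNoetherianRing S] {J : Ideal S} (hJ : J ≠ ⊤) {N : ℕ}
    (hN : maximalIdeal S ^ N ≤ J) : IsArtinianRing (S ⧸ J) := by
  haveI : Nontrivial (S ⧸ J) := Ideal.Quotient.nontrivial_iff.2 hJ
  haveI : IsLocalRing (S ⧸ J) :=
    IsLocalRing.of_surjective' (Ideal.Quotient.mk J) Ideal.Quotient.mk_surjective
  rw [isArtinianRing_iff_isNilpotent_maximalIdeal]
  refine ⟨N, ?_⟩
  have e : maximalIdeal (S ⧸ J) = (maximalIdeal S).map (Ideal.Quotient.mk J) := by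
    apply le_antisymm
    · intro z hz
      obtain ⟨z, rfl⟩ := Ideal.Quotient.mk_surjective z
      exact Ideal.mem_map_of_mem _ ((mk_mem_max hJ z).1 hz)
    · rw [Ideal.map_le_iff_le_comap]
      intro z hz
      exact (mk_mem_max hJ z).2 hz
  rw [e, ← Ideal.map_pow, Ideal.zero_eq_bot, Ideal.map_eq_bot_iff_le_ker, Ideal.mk_ker]
  exact hN

theorem SocS.injective [IsNoetherianRing S] {J : Ideal S} (hJ : J ≠ ⊤) {N : ℕ}
    (hN : maximalIdeal S ^ N ≤ J) (hs : SocS J) : Module.Injective (S ⧸ J) (S ⧸ J) := by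
  haveI : Nontrivial (S ⧸ J) := Ideal.Quotient.nontrivial_iff.2 hJ
  haveI : IsLocalRing (S ⧸ J) :=
    IsLocalRing.of_surjective' (Ideal.Quotient.mk J) Ideal.Quotient.mk_surjective
  haveI := isArtinian_quot hJ hN
  apply injective_of_soc
  intro u v hu hv hne
  obtain ⟨u, rfl⟩ := Ideal.Quotient.mk_surjective u
  obtain ⟨v, rfl⟩ := Ideal.Quotient.mk_surjective v
  have hz : ∀ z ∈ maximalIdeal S, Ideal.Quotient.mk J z ∈ maximalIdeal (S ⧸ J) := by
    intro z hz
    exact (mk_mem_max hJ z).2 hz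
  obtain ⟨c, hc⟩ := hs u v (fun z h => by
      have := hu _ (hz z h)
      rwa [← map_mul, Ideal.Quotient.eq_zero_iff_mem] at this)
    (fun z h => by
      have := hv _ (hz z h)
      rwa [← map_mul, Ideal.Quotient.eq_zero_iff_mem] at this)
    (fun h => hne (Ideal.Quotient.eq_zero_iff_mem.2 h))
  refine ⟨Ideal.Quotient.mk J c, ?_⟩
  rw [← map_mul]
  exact Ideal.Quotient.eq.2 hc

end Bridge

section Ext

theorem extend_of_injective {R : Type*} [CommRing R] {I : Ideal R}
    (hinj : Module.Injective (R ⧸ I) (R ⧸ I))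
    {M M' : Type*} [AddCommGroup M] [AddCommGroup M'] [Module R M] [Module R M']
    (hM' : ∀ r ∈ I, ∀ x : M', r • x = 0) (f : M →ₗ[R] M') (hf : Function.Injective f)
    (g : M →ₗ[R] R ⧸ I) : ∃ h : M' →ₗ[R] R ⧸ I, ∀ x, h (f x) = g x := by
  have t' : Module.IsTorsionBySet R M' I := fun x r => hM' r r.2 x
  have t : Module.IsTorsionBySet R M I := fun x r => hf (by rw [map_smul, map_zero, hM' r r.2])
  letI := t'.module
  letI := t.module
  haveI : IsScalarTower R (R ⧸ I) M' := t'.isScalarTower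
  haveI : IsScalarTower R (R ⧸ I) M := t.isScalarTower
  have hs : Function.Surjective (algebraMap R (R ⧸ I)) := Ideal.Quotient.mk_surjective
  obtain ⟨h, hh⟩ := (Module.Baer.of_injective hinj).extension_property
    (f.extendScalarsOfSurjective hs) hf (g.extendScalarsOfSurjective hs)
  refine ⟨h.restrictScalars R, fun x => ?_⟩
  exact LinearMap.congr_fun hh x

open IsLocalRing

variable {S : Type*} [CommRing S] [IsLocalRing S]

theorem SocS.of_injective {J : Ideal S} (hinj : Module.Injective (S ⧸ J) (S ⧸ J)) : SocS J := by
  intro u v hu hv hne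
  have kill : ∀ r ∈ J, ∀ x : S ⧸ J, r • x = 0 := by
    intro r hr x
    obtain ⟨x, rfl⟩ := Ideal.Quotient.mk_surjective x
    exact Ideal.Quotient.eq_zero_iff_mem.2 (J.mul_mem_right _ hr)
  let φ : S → (S →ₗ[S] S ⧸ J) := fun w => LinearMap.toSpanSingleton S (S ⧸ J) (Ideal.Quotient.mk J w)
  have hφ : ∀ w r, φ w r = Ideal.Quotient.mk J (r * w) := fun w r => rfl
  let f : (S ⧸ maximalIdeal S) →ₗ[S] S ⧸ J := (maximalIdeal S).liftQ (φ u)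
    (fun z hz => Ideal.Quotient.eq_zero_iff_mem.2 (hu z hz))
  let g : (S ⧸ maximalIdeal S) →ₗ[S] S ⧸ J := (maximalIdeal S).liftQ (φ v)
    (fun z hz => Ideal.Quotient.eq_zero_iff_mem.2 (hv z hz))
  have hf : Function.Injective f := by
    rw [← LinearMap.ker_eq_bot]
    apply Submodule.ker_liftQ_eq_bot
    intro r hr
    rw [mem_maximalIdeal]
    intro hr'
    apply hne
    have h1 : r * u ∈ J := Ideal.Quotient.eq_zero_iff_mem.1 hr
    exact (Ideal.unit_mul_mem_iff_mem _ hr').1 h1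
  obtain ⟨h, hh⟩ := extend_of_injective hinj kill f hf g
  have h1 := hh (Ideal.Quotient.mk _ 1)
  have h2 : f (Ideal.Quotient.mk _ 1) = Ideal.Quotient.mk J (1 * u) := rfl
  have h3 : g (Ideal.Quotient.mk _ 1) = Ideal.Quotient.mk J (1 * v) := rfl
  obtain ⟨c, hc⟩ := Ideal.Quotient.mk_surjective (h (Ideal.Quotient.mk J 1))
  refine ⟨c, ?_⟩
  rw [h2, h3, one_mul, one_mul] at h1
  have h4 : Ideal.Quotient.mk J u = u • Ideal.Quotient.mk J 1 := by
    rw [← mul_one u]; exact (congrArg _ (by simp) : Ideal.Quotient.mk J (u * 1) = Ideal.Quotient.mk J ((u * 1) * 1))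
  rw [h4, map_smul, ← hc] at h1
  have h5 : u • Ideal.Quotient.mk J c = Ideal.Quotient.mk J (u * c) := rfl
  rw [h5] at h1
  rw [mul_comm]
  exact Ideal.Quotient.eq.1 h1.symm

theorem exists_hom_ne_zero {J : Ideal S} (hJ : J ≠ ⊤) {N : ℕ} (hN : maximalIdeal S ^ N ≤ J)
    (hinj : Module.Injective (S ⧸ J) (S ⧸ J)) {M : Type*} [AddCommGroup M] [Module S M]
    (hM : ∀ r ∈ J, ∀ x : M, r • x = 0) {y : M} (hy : y ≠ 0) :
    ∃ h : M →ₗ[S] S ⧸ J, h y ≠ 0 := by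
  obtain ⟨u, hu, hzu⟩ : ∃ u, u ∉ J ∧ ∀ z ∈ maximalIdeal S, z * u ∈ J := by
    by_contra hcon
    push Not at hcon
    have : ∀ k, k ≤ N → maximalIdeal S ^ (N - k) ≤ J := by
      intro k
      induction k with
      | zero => intro _; simpa using hN
      | succ k ih =>
        intro hk
        have h1 := ih (by omega)
        intro u hu
        by_contra hne
        obtain ⟨z, hz, hzu⟩ := hcon u hne
        apply hzu
        apply h1
        have : N - k = (N - (k + 1)) + 1 := by omega
        rw [this, pow_succ']
        exact Ideal.mul_mem_mul hz hu
    have h0 := this N le_rfl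
    simp at h0
    exact hJ h0
  let t := LinearMap.toSpanSingleton S M y
  let f : (S ⧸ LinearMap.ker t) →ₗ[S] M := (LinearMap.ker t).liftQ t le_rfl
  have hf : Function.Injective f := by
    rw [← LinearMap.ker_eq_bot]
    exact Submodule.ker_liftQ_eq_bot _ _ _ le_rfl
  have hker : LinearMap.ker t ≤ maximalIdeal S := by
    apply le_maximalIdeal
    intro h
    apply hy
    have : (1 : S) ∈ LinearMap.ker t := h ▸ Submodule.mem_top
    have h1 : (1 : S) • y = 0 := this
    rwa [one_smul] at h1
  let g : (S ⧸ LinearMap.ker t) →ₗ[S] S ⧸ J := (LinearMap.ker t).liftQ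
    (LinearMap.toSpanSingleton S (S ⧸ J) (Ideal.Quotient.mk J u))
    (fun z hz => Ideal.Quotient.eq_zero_iff_mem.2 (hzu z (hker hz)))
  obtain ⟨h, hh⟩ := extend_of_injective hinj hM f hf g
  refine ⟨h, fun h0 => hu ?_⟩
  have h1 := hh (Submodule.Quotient.mk 1)
  have h2 : f (Submodule.Quotient.mk 1) = (1 : S) • y := rfl
  have h3 : g (Submodule.Quotient.mk 1) = Ideal.Quotient.mk J (1 * u) := rfl
  rw [h2, h3, one_smul, one_mul, h0] at h1
  exact Ideal.Quotient.eq_zero_iff_mem.1 h1.symm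

/-- Artin–Rees lifting of homomorphisms. -/
theorem artinRees_lift {R : Type*} [CommRing R] [IsNoetherianRing R] (n : Ideal R)
    (B : Type*) [AddCommGroup B] [Module R B] [Module.Finite R B] (N : ℕ) :
    ∃ m, ∀ K : Ideal R, K ≤ n ^ m → ∀ g : B →ₗ[R] R ⧸ K, ∃ φ : B →ₗ[R] R,
      ∀ b r, g b = Ideal.Quotient.mk K r → φ b - r ∈ n ^ N ⊔ K := by
  obtain ⟨b, p, hp⟩ := Module.Finite.exists_fin' R B
  haveI : Module.Finite R (LinearMap.ker p) := inferInstance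
  obtain ⟨a, q0, hq0⟩ := Module.Finite.exists_fin' R (LinearMap.ker p)
  let q : (Fin a → R) →ₗ[R] (Fin b → R) := (LinearMap.ker p).subtype ∘ₗ q0
  have hq : ∀ x, p x = 0 → ∃ y, q y = x := fun x hx => by
    obtain ⟨y, hy⟩ := hq0 ⟨x, hx⟩
    exact ⟨y, congrArg Subtype.val hy⟩
  have hpq : ∀ y, p (q y) = 0 := fun y => (q0 y).2
  let D : ((Fin b → R) →ₗ[R] R) →ₗ[R] (Fin a → R) :=
    LinearMap.pi fun i => LinearMap.applyₗ (q (Pi.single i 1))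
  have hD : ∀ ψ i, D ψ i = ψ (q (Pi.single i 1)) := fun ψ i => rfl
  obtain ⟨k, hk⟩ := Ideal.exists_pow_inf_eq_pow_smul n (LinearMap.range D)
  refine ⟨k + N, fun K hK g => ?_⟩
  -- lift `g ∘ p`
  choose c hc using fun i : Fin b => Ideal.Quotient.mk_surjective (g (p (Pi.single i 1)))
  let ψ : (Fin b → R) →ₗ[R] R := (Pi.basisFun R (Fin b)).constr R c
  have hψ : ∀ x, g (p x) = Ideal.Quotient.mk K (ψ x) := by
    have : g ∘ₗ p = (Submodule.mkQ K) ∘ₗ ψ := by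
      apply (Pi.basisFun R (Fin b)).ext
      intro i
      simp only [LinearMap.comp_apply, ψ, Module.Basis.constr_basis]
      rw [Pi.basisFun_apply]
      exact (hc i).symm
    intro x
    exact LinearMap.congr_fun this x
  have hmem : D ψ ∈ n ^ (k + N) • (⊤ : Submodule R (Fin a → R)) ⊓ LinearMap.range D := by
    refine ⟨?_, ⟨ψ, rfl⟩⟩
    rw [← (Pi.basisFun R (Fin a)).sum_repr (D ψ)]
    refine Submodule.sum_mem _ fun i _ => Submodule.smul_mem_smul ?_ trivial
    rw [Pi.basisFun_repr, hD]
    apply hK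
    rw [← Ideal.Quotient.eq_zero_iff_mem, ← hψ, hpq, map_zero]
  rw [hk _ (by omega)] at hmem
  have hmem2 : D ψ ∈ Submodule.map D (n ^ N • ⊤) := by
    rw [Submodule.map_smul'', Submodule.map_top]
    have : k + N - k = N := by omega
    rw [this] at hmem
    exact Submodule.smul_mono le_rfl inf_le_right hmem
  obtain ⟨χ, hχ, hDχ⟩ := hmem2
  have hχv : ∀ x, χ x ∈ n ^ N := by
    intro x
    refine Submodule.smul_induction_on hχ ?_ ?_
    · intro r hr f _
      exact Ideal.mul_mem_right _ _ hr
    · intro f g hf hg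
      exact Ideal.add_mem _ hf hg
  have hkill : LinearMap.ker p ≤ LinearMap.ker (ψ - χ) := by
    intro x hx
    obtain ⟨y, rfl⟩ := hq x hx
    have : (ψ - χ) ∘ₗ q = 0 := by
      apply (Pi.basisFun R (Fin a)).ext
      intro i
      rw [Pi.basisFun_apply]
      have := congrFun hDχ i
      rw [hD, hD] at this
      simp [this]
    exact LinearMap.congr_fun this y
  let e := p.quotKerEquivOfSurjective hp
  refine ⟨((LinearMap.ker p).liftQ (ψ - χ) hkill) ∘ₗ e.symm.toLinearMap, ?_⟩
  intro bb r hr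
  obtain ⟨x, rfl⟩ := hp bb
  have h1 : e.symm (p x) = Submodule.Quotient.mk x := by
    rw [LinearEquiv.symm_apply_eq]; rfl
  have h2 : (((LinearMap.ker p).liftQ (ψ - χ) hkill) ∘ₗ e.symm.toLinearMap) (p x) = ψ x - χ x := by
    rw [LinearMap.comp_apply, LinearEquiv.coe_coe, h1]; rfl
  rw [h2]
  have h3 : ψ x - r ∈ K := by
    rw [hψ] at hr
    exact Ideal.Quotient.eq.1 hr
  have : ψ x - χ x - r = - χ x + (ψ x - r) := by ring
  rw [this]
  exact Submodule.add_mem_sup (neg_mem (hχv x)) h3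

end Ext

section SocleLemma

open IsLocalRing

theorem ofList_pow_le {S : Type*} [CommRing S] (xs : List S) (k : ℕ) :
    Ideal.ofList (xs.map (· ^ (k + 1))) ≤ Ideal.ofList xs := by
  apply Ideal.span_le.2
  intro x hx
  obtain ⟨y, hy, rfl⟩ := List.mem_map.1 hx
  exact Ideal.pow_mem_of_mem (Ideal.ofList xs) (Ideal.subset_span hy) _ (by omega)

theorem prod_pow_mul_mem {S : Type*} [CommRing S] (xs : List S) (k : ℕ) (r : S)
    (hr : r ∈ Ideal.ofList xs) : xs.prod ^ k * r ∈ Ideal.ofList (xs.map (· ^ (k + 1))) := by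
  have : Ideal.ofList xs ≤ Submodule.comap (LinearMap.mulLeft S (xs.prod ^ k))
      (Ideal.ofList (xs.map (· ^ (k + 1)))) := by
    apply Ideal.span_le.2
    intro x hx
    change xs.prod ^ k * x ∈ Ideal.ofList (xs.map (· ^ (k + 1)))
    obtain ⟨c, hc⟩ := List.dvd_prod hx
    have e : xs.prod ^ k * x = c ^ k * x ^ (k + 1) := by rw [hc]; ring
    rw [e]
    exact Ideal.mul_mem_left _ _ (Ideal.subset_span (List.mem_map.2 ⟨x, hx, rfl⟩))
  exact this hr

theorem pow_le_ofList_pow {S : Type*} [CommRing S] [IsNoetherianRing S] (n : Ideal S) (xs : List S)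
    (k N : ℕ) (h : n ^ N ≤ Ideal.ofList xs) :
    ∃ N', n ^ N' ≤ Ideal.ofList (xs.map (· ^ (k + 1))) := by
  apply Ideal.exists_pow_le_of_le_radical_of_fg _ (IsNoetherian.noetherian n)
  have h1 : Ideal.ofList xs ≤ (Ideal.ofList (xs.map (· ^ (k + 1)))).radical := by
    apply Ideal.span_le.2
    intro x hx
    exact ⟨k + 1, Ideal.subset_span (List.mem_map.2 ⟨x, hx, rfl⟩)⟩
  intro z hz
  rw [← Ideal.radical_idem]
  exact ⟨N, h1 (h (Ideal.pow_mem_pow hz N))⟩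

variable {R B L : Type*} [CommRing R] [IsLocalRing R] [IsNoetherianRing R] [CommRing B]
  [Algebra R B] [Module.Finite R B] [CommRing L] [IsLocalRing L] [IsNoetherianRing L]
  [Algebra B L] [Algebra R L] [IsScalarTower R B L]

theorem map_ofList_pow (xs : List R) (k : ℕ) :
    (Ideal.ofList (xs.map (· ^ (k + 1)))).map (algebraMap R L) =
      Ideal.ofList ((xs.map (algebraMap R L)).map (· ^ (k + 1))) := by
  rw [Ideal.map_ofList]
  congr 1
  simp [Function.comp_def]

theorem lift_hom {xs : List R} (hxs : ∀ x ∈ xs, x ∈ maximalIdeal R) (hreg : RegSeq ⊥ xs)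
    (hinj : Module.Injective (R ⧸ Ideal.ofList xs) (R ⧸ Ideal.ofList xs))
    {N : ℕ} (hN : maximalIdeal R ^ N ≤ Ideal.ofList xs)
    (hxL : ∀ x ∈ xs.map (algebraMap R L), x ∈ maximalIdeal L)
    (hregL : RegSeq ⊥ (xs.map (algebraMap R L)))
    (f : B →ₗ[R] R ⧸ Ideal.ofList xs)
    (hf : ∀ b, algebraMap B L b ∈ Ideal.ofList (xs.map (algebraMap R L)) → f b = 0) :
    ∃ φ : B →ₗ[R] R, ∀ b, Ideal.Quotient.mk _ (φ b) = f b := by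
  obtain ⟨m, hm⟩ := artinRees_lift (maximalIdeal R) B N
  set K : Ideal R := Ideal.ofList (xs.map (· ^ (m + 1))) with hK
  have hKI : K ≤ Ideal.ofList xs := ofList_pow_le xs m
  have hIm : Ideal.ofList xs ≤ maximalIdeal R := Ideal.span_le.2 hxs
  have hKtop : K ≠ ⊤ := fun h => (Ideal.IsPrime.ne_top (I := maximalIdeal R) inferInstance)
    (top_le_iff.1 (h ▸ hKI.trans hIm))
  have hKm : K ≤ maximalIdeal R ^ m := by
    apply Ideal.span_le.2
    intro x hx
    obtain ⟨y, hy, rfl⟩ := List.mem_map.1 hx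
    exact Ideal.pow_le_pow_right (Nat.le_succ m) (Ideal.pow_mem_pow (hxs y hy) (m + 1))
  obtain ⟨N', hN'⟩ := pow_le_ofList_pow (maximalIdeal R) xs m N hN
  have hsK : SocS K := by
    have := SocS.pow_list m (J := ⊥) hxs hreg (by
      rw [bot_sup_eq]; exact SocS.of_injective hinj)
    rwa [bot_sup_eq] at this
  have hKinj := hsK.injective hKtop hN'
  let J : Submodule R B :=
    ((Ideal.ofList (xs.map (algebraMap R L))).comap (algebraMap B L)).restrictScalars R
  let J' : Submodule R B :=
    ((Ideal.ofList ((xs.map (algebraMap R L)).map (· ^ (m + 1)))).comap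
      (algebraMap B L)).restrictScalars R
  have hπ : ∀ b : B, algebraMap B L (xs.prod ^ m • b) =
      (xs.map (algebraMap R L)).prod ^ m * algebraMap B L b := by
    intro b
    rw [Algebra.smul_def, map_mul, ← IsScalarTower.algebraMap_apply, map_pow, map_list_prod]
  let ι : (B ⧸ J) →ₗ[R] (B ⧸ J') := J.mapQ J' (LinearMap.lsmul R B (xs.prod ^ m)) (by
    intro b hb
    change algebraMap B L (xs.prod ^ m • b) ∈
      Ideal.ofList ((xs.map (algebraMap R L)).map (· ^ (m + 1)))
    rw [hπ]
    exact prod_pow_mul_mem _ m _ hb)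
  have hι : Function.Injective ι := by
    rw [← LinearMap.ker_eq_bot]
    apply Submodule.ker_liftQ_eq_bot
    intro b hb
    have h1 : xs.prod ^ m • b ∈ J' := (Submodule.Quotient.mk_eq_zero J').1 hb
    have h2 : algebraMap B L (xs.prod ^ m • b) ∈
        Ideal.ofList ((xs.map (algebraMap R L)).map (· ^ (m + 1))) := h1
    rw [hπ] at h2
    have := colon_pow m (J := ⊥) hxL hregL (algebraMap B L b) (by rwa [bot_sup_eq])
    rw [bot_sup_eq] at this
    exact this
  let ρ : (R ⧸ Ideal.ofList xs) →ₗ[R] (R ⧸ K) :=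
    Submodule.mapQ (Ideal.ofList xs) K (LinearMap.lsmul R R (xs.prod ^ m)) (by
      intro b hb
      exact prod_pow_mul_mem _ m _ hb)
  have hρ : ∀ r, ρ (Ideal.Quotient.mk _ r) = Ideal.Quotient.mk K (xs.prod ^ m * r) := fun r => rfl
  have hkill : ∀ r ∈ K, ∀ x : B ⧸ J', r • x = 0 := by
    intro r hr x
    obtain ⟨x, rfl⟩ := Submodule.mkQ_surjective _ x
    rw [← map_smul]
    apply (Submodule.Quotient.mk_eq_zero J').2
    change algebraMap B L (r • x) ∈ Ideal.ofList ((xs.map (algebraMap R L)).map (· ^ (m + 1)))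
    rw [Algebra.smul_def, map_mul, ← IsScalarTower.algebraMap_apply, ← map_ofList_pow]
    exact Ideal.mul_mem_right _ _ (Ideal.mem_map_of_mem _ hr)
  obtain ⟨h, hh⟩ := extend_of_injective hKinj hkill ι hι (ρ ∘ₗ J.liftQ f hf)
  obtain ⟨φ, hφ⟩ := hm K hKm (h ∘ₗ J'.mkQ)
  refine ⟨φ, fun b => ?_⟩
  obtain ⟨r, hr⟩ := Ideal.Quotient.mk_surjective (f b)
  obtain ⟨r', hr'⟩ := Ideal.Quotient.mk_surjective ((h ∘ₗ J'.mkQ) b)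
  have h1 : φ b - r' ∈ Ideal.ofList xs := sup_le hN hKI (hφ b r' hr'.symm)
  have h2 : h (xs.prod ^ m • J'.mkQ b) = ρ (f b) := hh (J.mkQ b)
  rw [map_smul] at h2
  have h3 : xs.prod ^ m • h (J'.mkQ b) = Ideal.Quotient.mk K (xs.prod ^ m * r') := by
    have : h (J'.mkQ b) = Ideal.Quotient.mk K r' := hr'.symm
    rw [this]; rfl
  rw [h3, ← hr, hρ] at h2
  have h4 : xs.prod ^ m * (r' - r) ∈ K := by
    rw [mul_sub]
    exact Ideal.Quotient.eq.1 h2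
  have h5 := colon_pow m (J := ⊥) hxs hreg (r' - r) (by rwa [bot_sup_eq])
  rw [bot_sup_eq] at h5
  rw [← hr]
  apply Ideal.Quotient.eq.2
  have : φ b - r = (φ b - r') + (r' - r) := by ring
  rw [this]
  exact Ideal.add_mem _ h1 h5

theorem socS_localization {xs : List R} (hxs : ∀ x ∈ xs, x ∈ maximalIdeal R) (hreg : RegSeq ⊥ xs)
    (hinj : Module.Injective (R ⧸ Ideal.ofList xs) (R ⧸ Ideal.ofList xs))
    {N : ℕ} (hN : maximalIdeal R ^ N ≤ Ideal.ofList xs)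
    (hxL : ∀ x ∈ xs.map (algebraMap R L), x ∈ maximalIdeal L)
    (hregL : RegSeq ⊥ (xs.map (algebraMap R L)))
    (Q : Ideal B) [hQ : Q.IsMaximal] [IsLocalization.AtPrime L Q]
    (θ : B →ₗ[R] R) (hθ : ∀ f : B →ₗ[R] R, ∃ a, ∀ x, f x = θ (a * x)) :
    SocS (Ideal.ofList (xs.map (algebraMap R L))) := by
  set IL : Ideal L := Ideal.ofList (xs.map (algebraMap R L)) with hIL
  set I : Ideal R := Ideal.ofList xs with hI
  have hItop : I ≠ ⊤ := fun h => (Ideal.IsPrime.ne_top (I := maximalIdeal R) inferInstance)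
    (top_le_iff.1 (h ▸ (Ideal.span_le.2 hxs : I ≤ _)))
  haveI : IsNoetherianRing B := IsNoetherianRing.of_finite R B
  let J : Ideal B := IL.comap (algebraMap B L)
  have hJ : ∀ b, b ∈ J ↔ algebraMap B L b ∈ IL := fun b => Iff.rfl
  have hmapL : (I.map (algebraMap R B)).map (algebraMap B L) = IL := by
    rw [Ideal.map_map, ← IsScalarTower.algebraMap_eq, hI, hIL, Ideal.map_ofList]
  have hIBJ : I.map (algebraMap R B) ≤ J := by
    rw [← Ideal.map_le_iff_le_comap, hmapL]
  have hunit : ∀ s, s ∉ Q → IsUnit (algebraMap B L s) := fun s hs =>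
    IsLocalization.map_units L (⟨s, hs⟩ : Q.primeCompl)
  have hmaxL : ∀ z ∈ Q, algebraMap B L z ∈ maximalIdeal L := by
    intro z hz
    exact (IsLocalization.AtPrime.to_map_mem_maximal_iff L Q z).2 hz
  have hsJ : ∀ s, s ∉ Q → ∀ b, s * b ∈ J → b ∈ J := by
    intro s hs b hb
    rw [hJ, map_mul] at hb
    exact (Ideal.unit_mul_mem_iff_mem _ (hunit s hs)).1 hb
  -- common denominator
  obtain ⟨s, hsQ, hs⟩ : ∃ s, s ∉ Q ∧ ∀ j ∈ J, s * j ∈ I.map (algebraMap R B) := by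
    have h1 : ∀ j ∈ J, ∃ s, s ∉ Q ∧ s * j ∈ I.map (algebraMap R B) := by
      intro j hj
      rw [hJ, ← hmapL, IsLocalization.mem_map_algebraMap_iff Q.primeCompl] at hj
      obtain ⟨⟨a, s⟩, h⟩ := hj
      rw [← map_mul] at h
      obtain ⟨t, ht⟩ := (IsLocalization.eq_iff_exists Q.primeCompl L).1 h
      refine ⟨t * s, (t * s).2, ?_⟩
      have e : (t : B) * s * j = t * a := by
        have : (t : B) * s * j = t * (j * s) := by ring
        rw [this]; exact ht
      rw [e]
      exact Ideal.mul_mem_left _ _ a.2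
    obtain ⟨G, hG⟩ := IsNoetherian.noetherian J
    have h2 : ∀ G' : Finset B, (↑G' : Set B) ⊆ J →
        ∃ s, s ∉ Q ∧ ∀ j ∈ G', s * j ∈ I.map (algebraMap R B) := by
      intro G'
      induction G' using Finset.induction_on with
      | empty => intro _; exact ⟨1, (Ideal.ne_top_iff_one _).1 hQ.ne_top, by simp⟩
      | insert g G' hg ih =>
        intro hsub
        obtain ⟨s1, hs1, hs1'⟩ := ih (fun x hx => hsub (by simp [Finset.mem_coe.1 hx]))
        obtain ⟨s2, hs2, hs2'⟩ := h1 g (hsub (by simp))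
        refine ⟨s1 * s2, fun h => (hQ.isPrime.mem_or_mem h).elim hs1 hs2, ?_⟩
        intro j hj
        rcases Finset.mem_insert.1 hj with rfl | hj
        · rw [mul_assoc]; exact Ideal.mul_mem_left _ _ hs2'
        · rw [mul_comm s1, mul_assoc]; exact Ideal.mul_mem_left _ _ (hs1' j hj)
    obtain ⟨s, hs, hs'⟩ := h2 G (by rw [← hG]; exact Submodule.subset_span)
    refine ⟨s, hs, ?_⟩
    have : J ≤ Submodule.comap (LinearMap.mulLeft B s) (I.map (algebraMap R B)) := by
      rw [← hG]
      exact Submodule.span_le.2 hs'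
    exact fun j hj => this hj
  have hθI : ∀ b ∈ I.map (algebraMap R B), θ b ∈ I := by
    intro b hb
    refine Submodule.span_induction (p := fun b _ => ∀ c, θ (c * b) ∈ I) ?_ ?_ ?_ ?_ hb 1 |> fun h => by
      simpa using h
    · rintro _ ⟨r, hr, rfl⟩ c
      rw [mul_comm, ← Algebra.smul_def, map_smul]
      exact Ideal.mul_mem_right _ _ hr
    · intro c; simp
    · intro x y _ _ hx hy c
      rw [mul_add, map_add]
      exact Ideal.add_mem _ (hx c) (hy c)
    · intro a x _ hx c
      rw [smul_eq_mul, ← mul_assoc]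
      exact hx _
  -- the main claim for elements of `B`
  have main : ∀ u v : B, (∀ z ∈ Q, z * u ∈ J) → (∀ z ∈ Q, z * v ∈ J) → u ∉ J →
      ∃ c, s * v - c * u ∈ J := by
    intro u v hu hv hne
    by_contra hcon
    push Not at hcon
    let U : Submodule R B := (J ⊔ Ideal.span {u}).restrictScalars R
    let V : Submodule R B := J.restrictScalars R
    have killJ : ∀ r ∈ I, ∀ x : B, r • x ∈ J := by
      intro r hr x
      rw [Algebra.smul_def]
      exact Ideal.mul_mem_right _ _ (hIBJ (Ideal.mem_map_of_mem _ hr))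
    have hy1 : U.mkQ (s * v) ≠ 0 := by
      intro h0
      have : s * v ∈ J ⊔ Ideal.span {u} := (Submodule.Quotient.mk_eq_zero U).1 h0
      obtain ⟨c, hc⟩ := mem_sup_span.1 this
      exact hcon c (by rwa [mul_comm c])
    have hy2 : V.mkQ (s * u) ≠ 0 := by
      intro h0
      have : s * u ∈ J := (Submodule.Quotient.mk_eq_zero V).1 h0
      exact hne (hsJ s hsQ u this)
    obtain ⟨f, hf⟩ := exists_hom_ne_zero hItop hN hinj (M := B ⧸ U) (by
      intro r hr x
      obtain ⟨x, rfl⟩ := Submodule.mkQ_surjective _ x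
      rw [← map_smul]
      exact (Submodule.Quotient.mk_eq_zero U).2 (Ideal.mem_sup_left (killJ r hr x))) hy1
    obtain ⟨g, hg⟩ := exists_hom_ne_zero hItop hN hinj (M := B ⧸ V) (by
      intro r hr x
      obtain ⟨x, rfl⟩ := Submodule.mkQ_surjective _ x
      rw [← map_smul]
      exact (Submodule.Quotient.mk_eq_zero V).2 (killJ r hr x)) hy2
    have hfU : ∀ b ∈ J ⊔ Ideal.span {u}, (f ∘ₗ U.mkQ) b = 0 := by
      intro b hb
      have : U.mkQ b = 0 := (Submodule.Quotient.mk_eq_zero U).2 hb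
      rw [LinearMap.comp_apply, this, map_zero]
    obtain ⟨φ, hφ⟩ := lift_hom hxs hreg hinj hN hxL hregL (f ∘ₗ U.mkQ)
      (fun b hb => hfU b (Ideal.mem_sup_left hb))
    obtain ⟨ψ, hψ⟩ := lift_hom hxs hreg hinj hN hxL hregL (g ∘ₗ V.mkQ) (fun b hb => by
      have : V.mkQ b = 0 := (Submodule.Quotient.mk_eq_zero V).2 hb
      rw [LinearMap.comp_apply, this, map_zero])
    obtain ⟨a, ha⟩ := hθ φ
    obtain ⟨a', ha'⟩ := hθ ψ
    by_cases haQ : a ∈ Q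
    · apply hf
      have h1 := hφ (s * v)
      rw [LinearMap.comp_apply] at h1
      rw [← h1, ha]
      apply Ideal.Quotient.eq_zero_iff_mem.2
      apply hθI
      have : a * (s * v) = s * (a * v) := by ring
      rw [this]
      exact hs _ (hv a haQ)
    · obtain ⟨y, i, hi, hyi⟩ := hQ.exists_inv haQ
      apply hg
      have h1 := hψ (s * u)
      rw [LinearMap.comp_apply] at h1
      rw [← h1, ha']
      have e : a' * (s * u) = a * (y * a' * s * u) + s * (a' * i * u) := by
        calc a' * (s * u) = (y * a + i) * (a' * (s * u)) := by rw [hyi, one_mul]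
          _ = _ := by ring
      rw [e, map_add, map_add, ← ha, hφ, hfU _ (Ideal.mem_sup_right
        (Ideal.mul_mem_left _ _ (Ideal.mem_span_singleton_self u))), zero_add]
      apply Ideal.Quotient.eq_zero_iff_mem.2
      apply hθI
      exact hs _ (hu _ (Ideal.mul_mem_left _ _ hi))
  intro u v hu hv hne
  obtain ⟨⟨b, t⟩, hb⟩ := IsLocalization.surj Q.primeCompl u
  obtain ⟨⟨c, t'⟩, hc⟩ := IsLocalization.surj Q.primeCompl v
  simp only at hb hc
  have ut := IsLocalization.map_units L t
  have ut' := IsLocalization.map_units L t'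
  obtain ⟨d, hd⟩ := main b c (fun z hz => by
      rw [hJ, map_mul, ← hb, ← mul_assoc]
      exact Ideal.mul_mem_right _ _ (hu _ (hmaxL z hz)))
    (fun z hz => by
      rw [hJ, map_mul, ← hc, ← mul_assoc]
      exact Ideal.mul_mem_right _ _ (hv _ (hmaxL z hz)))
    (fun h => hne (by
      rw [hJ, ← hb, mul_comm] at h
      exact (Ideal.unit_mul_mem_iff_mem _ ut).1 h))
  rw [hJ, map_sub, map_mul, map_mul, ← hb, ← hc] at hd
  have hst := (hunit s hsQ).mul ut'
  obtain ⟨w, hw⟩ := hst.exists_left_inv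
  refine ⟨w * (algebraMap B L d * algebraMap B L t), ?_⟩
  have := Ideal.mul_mem_left _ w hd
  have e : w * (algebraMap B L s * (v * algebraMap B L t') - algebraMap B L d * (u * algebraMap B L t))
    = (w * (algebraMap B L s * algebraMap B L t')) * v - w * (algebraMap B L d * algebraMap B L t) * u := by
    ring
  rw [e, hw, one_mul] at this
  exact this

end SocleLemma

section EakinNagata

variable {P A : Type*} [CommRing P] [CommRing A] [Algebra P A]

theorem eakin_nagata_aux [Module.Finite P A] [IsNoetherianRing A] (𝔞 : Ideal A) :
    IsNoetherian P (A ⧸ 𝔞.restrictScalars P) := by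
  induction 𝔞 using IsNoetherian.induction with
  | hgt 𝔞 ih =>
  let W : P → Submodule P A := fun r => Submodule.map (LinearMap.lsmul P A r) ⊤
  have hWle : ∀ r (N : Submodule P A), W r ≤ N ↔ ∀ a, r • a ∈ N := by
    intro r N
    constructor
    · intro h a
      exact h ⟨a, trivial, rfl⟩
    · rintro h _ ⟨a, -, rfl⟩
      exact h a
  have hWfg : ∀ r, (W r).FG := fun r => Submodule.FG.map _ Module.Finite.fg_top
  let Z : Set (Submodule P A) :=
    {N | 𝔞.restrictScalars P ≤ N ∧ ∀ r, W r ≤ N → W r ≤ 𝔞.restrictScalars P}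
  obtain ⟨N0, -, hN0⟩ := zorn_le_nonempty₀ Z (by
    intro c hcZ hc N hN
    refine ⟨sSup c, ⟨(hcZ hN).1.trans (le_sSup hN), ?_⟩, fun z hz => le_sSup hz⟩
    intro r hr
    obtain ⟨N', hN', hle⟩ := (CompleteLattice.isCompactElement_iff_le_of_directed_sSup_le _ _).1
      ((Submodule.fg_iff_compact _).1 (hWfg r)) c ⟨N, hN⟩ hc.directedOn hr
    exact (hcZ hN').2 r hle) (𝔞.restrictScalars P) ⟨le_rfl, fun r h => h⟩
  have hN0Z : N0 ∈ Z := hN0.prop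
  have hnoeth : IsNoetherian P (A ⧸ N0) := by
    refine ⟨fun M => ?_⟩
    by_cases hM : Submodule.comap N0.mkQ M ∈ Z
    · have hle : N0 ≤ Submodule.comap N0.mkQ M := by
        intro x hx
        change N0.mkQ x ∈ M
        have : N0.mkQ x = 0 := (Submodule.Quotient.mk_eq_zero _).2 hx
        rw [this]; exact M.zero_mem
      have h1 := hN0.le_of_ge hM hle
      have : M = ⊥ := by
        rw [eq_bot_iff]
        intro x hx
        obtain ⟨x, rfl⟩ := N0.mkQ_surjective x
        exact (Submodule.Quotient.mk_eq_zero _).2 (h1 hx)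
      rw [this]; exact Submodule.fg_bot
    · have hle : N0 ≤ Submodule.comap N0.mkQ M := by
        intro x hx
        change N0.mkQ x ∈ M
        have : N0.mkQ x = 0 := (Submodule.Quotient.mk_eq_zero _).2 hx
        rw [this]; exact M.zero_mem
      obtain ⟨r, hr1, hr2⟩ : ∃ r, W r ≤ Submodule.comap N0.mkQ M ∧
          ¬ W r ≤ 𝔞.restrictScalars P := by
        by_contra hcon
        push Not at hcon
        exact hM ⟨hN0Z.1.trans hle, hcon⟩
      let 𝔟 : Ideal A := 𝔞 ⊔ Ideal.span {algebraMap P A r}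
      have hlt : 𝔞 < 𝔟 := by
        refine lt_of_le_of_ne le_sup_left fun h => hr2 ?_
        rw [hWle]
        intro a
        change r • a ∈ 𝔞
        rw [h, Algebra.smul_def]
        exact Ideal.mul_mem_right _ _ (Ideal.mem_sup_right (Ideal.mem_span_singleton_self _))
      have hb := ih 𝔟 hlt
      let M' : Submodule P (A ⧸ N0) := (W r).map N0.mkQ
      have hM' : M'.FG := (hWfg r).map _
      have hM'M : M' ≤ M := by
        rw [Submodule.map_le_iff_le_comap]; exact hr1
      have hq : IsNoetherian P ((A ⧸ N0) ⧸ M') := by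
        let F : A →ₗ[P] ((A ⧸ N0) ⧸ M') := M'.mkQ ∘ₗ N0.mkQ
        have hF : 𝔟.restrictScalars P ≤ LinearMap.ker F := by
          intro x hx
          obtain ⟨c, hc⟩ := mem_sup_span.1 (show x ∈ 𝔞 ⊔ Ideal.span {algebraMap P A r} from hx)
          have e : x = (x - algebraMap P A r * c) + r • c := by
            rw [Algebra.smul_def]; ring
          rw [e]
          refine Submodule.add_mem _ ?_ ?_
          · have : N0.mkQ (x - algebraMap P A r * c) = 0 :=
              (Submodule.Quotient.mk_eq_zero _).2 (hN0Z.1 hc)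
            change M'.mkQ (N0.mkQ (x - algebraMap P A r * c)) = 0
            rw [this, map_zero]
          · change M'.mkQ (N0.mkQ (r • c)) = 0
            exact (Submodule.Quotient.mk_eq_zero _).2 ⟨r • c, ⟨c, trivial, rfl⟩, rfl⟩
        refine isNoetherian_of_surjective ((𝔟.restrictScalars P).liftQ F hF) ?_
        rw [LinearMap.range_eq_top]
        intro y
        obtain ⟨y, rfl⟩ := M'.mkQ_surjective y
        obtain ⟨y, rfl⟩ := N0.mkQ_surjective y
        exact ⟨Submodule.Quotient.mk y, rfl⟩
      apply Submodule.fg_of_fg_map_of_fg_inf_ker M'.mkQ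
      · exact IsNoetherian.noetherian _
      · rw [Submodule.ker_mkQ, inf_eq_right.2 hM'M]
        exact hM'
  -- `P / I0` is noetherian
  obtain ⟨n, e, he⟩ := Module.Finite.exists_fin (R := P) (M := A)
  let F : P →ₗ[P] (Fin n → A ⧸ N0) := LinearMap.pi fun i => LinearMap.toSpanSingleton P _ (N0.mkQ (e i))
  have hF : ∀ r, F r = 0 → ∀ a, r • a ∈ 𝔞 := by
    intro r hr
    have h1 : W r ≤ N0 := by
      rw [hWle]
      have : (⊤ : Submodule P A) ≤ Submodule.comap (LinearMap.lsmul P A r) N0 := by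
        rw [← he, Submodule.span_le]
        rintro _ ⟨i, rfl⟩
        have h2 : r • N0.mkQ (e i) = 0 := congrFun hr i
        rw [← map_smul] at h2
        exact (Submodule.Quotient.mk_eq_zero N0).1 h2
      exact fun a => this (Submodule.mem_top (x := a))
    exact fun a => (hWle r _).1 (hN0Z.2 r h1) a
  have hPI : IsNoetherian P (P ⧸ LinearMap.ker F) :=
    isNoetherian_of_injective ((LinearMap.ker F).liftQ F le_rfl)
      (LinearMap.ker_eq_bot.1 (Submodule.ker_liftQ_eq_bot _ _ _ le_rfl))
  let G : Fin n → P →ₗ[P] (A ⧸ 𝔞.restrictScalars P) := fun i =>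
    LinearMap.toSpanSingleton P _ ((𝔞.restrictScalars P).mkQ (e i))
  have hG : ∀ i, LinearMap.ker F ≤ LinearMap.ker (G i) := by
    intro i r hr
    change r • (𝔞.restrictScalars P).mkQ (e i) = 0
    rw [← map_smul]
    exact (Submodule.Quotient.mk_eq_zero _).2 (hF r hr (e i))
  have hR : ∀ i, IsNoetherian P (LinearMap.range ((LinearMap.ker F).liftQ (G i) (hG i))) := fun i =>
    isNoetherian_of_surjective (LinearMap.rangeRestrict ((LinearMap.ker F).liftQ (G i) (hG i)))
      (LinearMap.range_rangeRestrict _)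
  have hsup : IsNoetherian P
      (⨆ i, LinearMap.range ((LinearMap.ker F).liftQ (G i) (hG i)) : Submodule P _) :=
    isNoetherian_iSup
  have htop : (⨆ i, LinearMap.range ((LinearMap.ker F).liftQ (G i) (hG i)) : Submodule P _) = ⊤ := by
    rw [eq_top_iff, ← (𝔞.restrictScalars P).range_mkQ, LinearMap.range_eq_map, ← he,
      Submodule.map_span_le]
    rintro _ ⟨i, rfl⟩
    refine Submodule.mem_iSup_of_mem i ⟨Submodule.Quotient.mk 1, ?_⟩
    change (1 : P) • (𝔞.restrictScalars P).mkQ (e i) = _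
    rw [one_smul]
  rw [htop] at hsup
  exact isNoetherian_top_iff.1 hsup

theorem eakin_nagata [Module.Finite P A] [IsNoetherianRing A]
    (hinj : Function.Injective (algebraMap P A)) : IsNoetherianRing P := by
  have h := eakin_nagata_aux (P := P) (⊥ : Ideal A)
  refine isNoetherian_of_injective
    (((⊥ : Ideal A).restrictScalars P).mkQ ∘ₗ Algebra.linearMap P A) ?_
  intro x y hxy
  apply hinj
  have h1 : (algebraMap P A x) - algebraMap P A y ∈ (⊥ : Ideal A).restrictScalars P :=
    (Submodule.Quotient.eq _).1 hxy
  have h2 : (algebraMap P A x) - algebraMap P A y = 0 := h1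
  exact sub_eq_zero.1 h2

end EakinNagata

section Dim

theorem dim_le_of_integral {R S : Type*} [CommRing R] [CommRing S] [Algebra R S]
    [Algebra.IsIntegral R S] : ringKrullDim S ≤ ringKrullDim R := by
  refine Order.krullDim_le_of_strictMono (PrimeSpectrum.comap (algebraMap R S)) ?_
  intro p q h
  exact Ideal.IsIntegral.comap_lt_comap (R := R) (I := p.asIdeal) (J := q.asIdeal) h

theorem dim_eq_of_integral {R S : Type*} [CommRing R] [CommRing S] [Algebra R S]
    [Algebra.IsIntegral R S] (hinj : Function.Injective (algebraMap R S)) :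
    ringKrullDim S = ringKrullDim R := by
  have := (faithfulSMul_iff_algebraMap_injective R S).2 hinj
  refine le_antisymm dim_le_of_integral ?_
  refine iSup_le fun l => ?_
  obtain ⟨P, hP, hPl⟩ := Ideal.nonempty_primesOver (S := S) (l.head.asIdeal)
  obtain ⟨L, hL, -⟩ := Ideal.exists_ltSeries_of_hasGoingUp (S := S) l P
  rw [← hL]
  exact le_iSup (fun l : LTSeries (PrimeSpectrum S) => (l.length : WithBot ℕ∞)) L

theorem height_le_under {R S : Type*} [CommRing R] [CommRing S] [Algebra R S]
    [Algebra.IsIntegral R S] (Q : Ideal S) [Q.IsPrime] : Q.height ≤ (Q.under R).height := by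
  have h := Order.height_le_height_apply_of_strictMono (PrimeSpectrum.comap (algebraMap R S))
    (fun p q h => Ideal.IsIntegral.comap_lt_comap (R := R) (I := p.asIdeal) (J := q.asIdeal) h)
    (⟨Q, inferInstance⟩ : PrimeSpectrum S)
  rw [← PrimeSpectrum.height_eq_orderHeight, ← PrimeSpectrum.height_eq_orderHeight] at h
  exact h

theorem height_under_le {R S : Type*} [CommRing R] [CommRing S] [Algebra R S]
    [IsDomain S] [IsNoetherianRing R] [IsNoetherianRing S] [IsIntegrallyClosed R]
    [Algebra.IsIntegral R S] (hinj : Function.Injective (algebraMap R S))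
    (Q : Ideal S) [Q.IsPrime] : (Q.under R).height ≤ Q.height := by
  have := (faithfulSMul_iff_algebraMap_injective R S).2 hinj
  have : Q.LiesOver (Q.under R) := ⟨rfl⟩
  rw [Ideal.height_eq_height_add_of_liesOver_of_hasGoingDown (Q.under R) Q]
  exact le_self_add

theorem dim_quot_under {R S : Type*} [CommRing R] [CommRing S] [Algebra R S]
    [Algebra.IsIntegral R S] (Q : Ideal S) :
    ringKrullDim (S ⧸ Q) = ringKrullDim (R ⧸ Q.under R) := by
  have : Algebra.IsIntegral (R ⧸ Q.under R) (S ⧸ Q) := inferInstance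
  apply dim_eq_of_integral
  exact Ideal.algebraMap_quotient_injective

theorem height_maximal_mvPoly {k : Type*} [Field k] (s : ℕ) (M : Ideal (MvPolynomial (Fin s) k))
    [hM : M.IsMaximal] : M.height = s := by
  induction s with
  | zero =>
    have h1 : (M.height : WithBot ℕ∞) ≤ ringKrullDim (MvPolynomial (Fin 0) k) :=
      Ideal.height_le_ringKrullDim_of_isPrime
    rw [MvPolynomial.ringKrullDim_of_isNoetherianRing] at h1
    simp at h1
    simpa using h1
  | succ s ih =>
    let e := (MvPolynomial.finSuccEquiv k s).toRingEquiv
    rw [← RingEquiv.height_map e]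
    have : (M.map e).IsMaximal := Ideal.map_isMaximal_of_equiv e
    have h2 : ((M.map e).comap (Polynomial.C)).IsMaximal :=
      Polynomial.isMaximal_comap_C_of_isJacobsonRing _
    have h3 := ih _ (hM := h2)
    have : (M.map e).LiesOver ((M.map e).comap (Polynomial.C)) := ⟨rfl⟩
    rw [Polynomial.height_eq_height_add_one ((M.map e).comap (Polynomial.C)) (M.map e), h3]
    simp

theorem dim_mvPoly {k : Type*} [Field k] (s : ℕ) :
    ringKrullDim (MvPolynomial (Fin s) k) = s := by
  rw [MvPolynomial.ringKrullDim_of_isNoetherianRing]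
  simp

theorem mvPoly_formula {k : Type*} [Field k] (n : ℕ) : ∀ (s : ℕ)
    (q : Ideal (MvPolynomial (Fin s) k)) [q.IsPrime], q.height ≤ n →
    (s : WithBot ℕ∞) ≤ (q.height : WithBot ℕ∞) + ringKrullDim (MvPolynomial (Fin s) k ⧸ q) := by
  induction n using Nat.strong_induction_on with
  | _ n ih =>
  intro s q hq hn
  by_cases hq0 : q = ⊥
  · subst hq0
    rw [ringKrullDim_eq_of_ringEquiv (RingEquiv.quotientBot _), dim_mvPoly]
    simp
  obtain ⟨f, hfq, hf⟩ := hq.exists_mem_prime_of_ne_bot hq0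
  let S := MvPolynomial (Fin s) k
  let I : Ideal S := Ideal.span {f}
  have hI : I.IsPrime := (Ideal.span_singleton_prime hf.ne_zero).2 hf
  have hIq : I ≤ q := by simpa [I, Ideal.span_le] using hfq
  let Q : Ideal (S ⧸ I) := q.map (Ideal.Quotient.mk I)
  have hQc : Q.comap (Ideal.Quotient.mk I) = q := by
    rw [Ideal.comap_map_of_surjective _ Ideal.Quotient.mk_surjective]
    simpa [← RingHom.ker_eq_comap_bot] using hIq
  have hQ : Q.IsPrime := Ideal.map_isPrime_of_surjective Ideal.Quotient.mk_surjective
    (by simpa using hIq)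
  have hQdim : ringKrullDim ((S ⧸ I) ⧸ Q) = ringKrullDim (S ⧸ q) :=
    ringKrullDim_eq_of_ringEquiv (DoubleQuot.quotQuotEquivQuotOfLE hIq)
  obtain ⟨s', g, hg, hgi⟩ := exists_integral_inj_algHom_of_fg k (S ⧸ I)
  algebraize [g.toRingHom]
  let S' := MvPolynomial (Fin s') k
  have hinj : Function.Injective (algebraMap S' (S ⧸ I)) := hg
  have hdim : ringKrullDim (S ⧸ I) = s' := by
    rw [dim_eq_of_integral hinj, dim_mvPoly]
  have h1 : (Q.under S').height ≤ Q.height := height_under_le hinj Q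
  have h2 : Q.height + 1 ≤ q.height := by
    obtain ⟨l, hl, hlen⟩ := Q.exists_ltSeries_length_eq_height
    let F : PrimeSpectrum (S ⧸ I) → PrimeSpectrum S :=
      PrimeSpectrum.comap (Ideal.Quotient.mk I)
    have hF : StrictMono F := by
      have hFi := PrimeSpectrum.comap_injective_of_surjective (Ideal.Quotient.mk I)
        Ideal.Quotient.mk_surjective
      have hmono : Monotone F := fun a b h => Ideal.comap_mono h
      exact hmono.strictMono_of_injective hFi
    let l' := l.map F hF
    have hb : (⊥ : PrimeSpectrum S) < l'.head := by
      refine lt_of_le_of_ne bot_le ?_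
      intro h
      have hfm : f ∈ (F l.head).asIdeal := by
        change Ideal.Quotient.mk I f ∈ l.head.asIdeal
        rw [Ideal.Quotient.eq_zero_iff_mem.2 (Ideal.mem_span_singleton_self f)]
        exact zero_mem _
      have hh : l'.head = F l.head := rfl
      rw [← hh, ← h] at hfm
      exact hf.ne_zero (by simpa using hfm)
    have h := Order.length_le_height (p := l'.cons ⊥ hb) (x := ⟨q, hq⟩) (by
      apply le_of_eq
      rw [RelSeries.last_cons]
      have hh : l'.last = F l.last := rfl
      rw [hh, hl]
      exact PrimeSpectrum.ext hQc)
    rw [← PrimeSpectrum.height_eq_orderHeight] at h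
    rw [← hlen]
    simpa [l'] using h
  have h3 : (s : WithBot ℕ∞) ≤ s' + 1 := by
    obtain ⟨M, hM, hqM⟩ := Ideal.exists_le_maximal q hq.ne_top
    rw [← hdim]
    refine le_trans (le_of_eq ?_)
      (Ideal.height_le_ringKrullDim_quotient_add_one (p := M) (hqM hfq))
    rw [height_maximal_mvPoly]; rfl
  obtain ⟨m, hm⟩ := ENat.ne_top_iff_exists.1 (ne_top_of_le_ne_top (ENat.natCast_ne_top n) (le_self_add.trans (h2.trans hn)))
  have hmn : m < n := by
    have := h2.trans hn
    rw [← hm] at this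
    exact_mod_cast this
  have h4 := ih m hmn s' (Q.under S') (h1.trans hm.ge)
  rw [← dim_quot_under, hQdim] at h4
  calc (s : WithBot ℕ∞) ≤ s' + 1 := h3
    _ ≤ (((Q.under S').height : WithBot ℕ∞) + ringKrullDim (S ⧸ q)) + 1 := by gcongr
    _ ≤ ((Q.height : WithBot ℕ∞) + ringKrullDim (S ⧸ q)) + 1 := by
      gcongr; exact WithBot.coe_le_coe.2 h1
    _ = ((Q.height + 1 : ℕ∞) : WithBot ℕ∞) + ringKrullDim (S ⧸ q) := by
      push_cast; ring
    _ ≤ _ := by gcongr; exact WithBot.coe_le_coe.2 h2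

theorem height_add_dim_quot_le {R : Type*} [CommRing R] (q : Ideal R) [hq : q.IsPrime] :
    (q.height : WithBot ℕ∞) + ringKrullDim (R ⧸ q) ≤ ringKrullDim R := by
  have h1 : ringKrullDim (R ⧸ q) = (Order.coheight (⟨q, hq⟩ : PrimeSpectrum R) : ℕ∞) := by
    rw [ringKrullDim_quotient, Order.coheight_eq_krullDim_Ici]
    have : PrimeSpectrum.zeroLocus (R := R) q = Set.Ici (⟨q, hq⟩ : PrimeSpectrum R) := by
      ext p; rfl
    rw [this]
  have : Nonempty (PrimeSpectrum R) := ⟨⟨q, hq⟩⟩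
  rw [h1, ringKrullDim, Order.krullDim_eq_iSup_height_add_coheight_of_nonempty]
  have h2 : q.height = Order.height (⟨q, hq⟩ : PrimeSpectrum R) :=
    PrimeSpectrum.height_eq_orderHeight ⟨q, hq⟩
  rw [h2, ← WithBot.coe_add, WithBot.coe_le_coe]
  exact le_iSup (fun a : PrimeSpectrum R => Order.height a + Order.coheight a) ⟨q, hq⟩

/-- heights agree for a finite extension of a subring in a finitely generated domain -/
theorem height_under_eq {k A P : Type*} [Field k] [CommRing A] [IsDomain A] [Algebra k A]
    [Algebra.FiniteType k A] [CommRing P] [Algebra P A] [Algebra.IsIntegral P A]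
    (hinj : Function.Injective (algebraMap P A)) (Q : Ideal A) [Q.IsPrime] :
    (Q.under P).height = Q.height := by
  refine le_antisymm ?_ (height_le_under Q)
  obtain ⟨s, g, hg, hgi⟩ := exists_integral_inj_algHom_of_fg k A
  algebraize [g.toRingHom]
  let S := MvPolynomial (Fin s) k
  have hinjS : Function.Injective (algebraMap S A) := hg
  have : IsNoetherianRing A := Algebra.FiniteType.isNoetherianRing k A
  have h1 := height_add_dim_quot_le (Q.under P)
  rw [← dim_quot_under, ← dim_eq_of_integral hinj, dim_eq_of_integral hinjS, dim_mvPoly] at h1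
  obtain ⟨n, hn⟩ := ENat.ne_top_iff_exists.1 (Ideal.height_ne_top_of_isPrime (I := Q.under S))
  have h2 := mvPoly_formula n s (Q.under S) hn.ge
  rw [← dim_quot_under] at h2
  have h3 : (Q.under S).height ≤ Q.height := height_under_le hinjS Q
  have h4 := h1.trans h2
  have h5 : ringKrullDim (A ⧸ Q) ≤ s := by
    rw [← dim_mvPoly (k := k), ← dim_eq_of_integral hinjS]
    exact ringKrullDim_quotient_le Q
  have h6 : ringKrullDim (A ⧸ Q) ≠ ⊥ := by
    have := ringKrullDim_nonneg_of_nontrivial (R := A ⧸ Q)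
    intro h
    rw [h] at this
    simp at this
  obtain ⟨d, hd⟩ := WithBot.ne_bot_iff_exists.1 h6
  rw [← hd] at h4 h5
  refine le_trans ?_ h3
  have h7 : d ≠ ⊤ := by
    rintro rfl
    have : (⊤ : ℕ∞) ≤ s := by exact_mod_cast h5
    simp at this
  have h8 : (Q.under P).height + d ≤ (Q.under S).height + d := by exact_mod_cast h4
  exact (ENat.add_le_add_iff_right h7).1 h8

end Dim

section Bridge

theorem regSeq_iff_getElem {S : Type*} [CommRing S] : ∀ (xs : List S) (J : Ideal S),
    RegSeq J xs ↔ ∀ i (h : i < xs.length), RegMod xs[i] (J ⊔ Ideal.ofList (xs.take i)) := by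
  intro xs
  induction xs with
  | nil => intro J; simp [RegSeq]
  | cons x xs ih =>
    intro J
    simp only [RegSeq, ih]
    constructor
    · rintro ⟨h1, h2⟩ i hi
      cases i with
      | zero => simpa using h1
      | succ i =>
        have := h2 i (by simpa using hi)
        simpa [sup_assoc] using this
    · intro h
      have h0 := h 0 (by simp)
      rw [List.getElem_cons_zero] at h0
      refine ⟨by simpa using h0, fun i hi => ?_⟩
      have := h (i + 1) (by simpa using hi)
      simpa [sup_assoc] using this

theorem isWeaklyRegular_iff_regSeq {S : Type*} [CommRing S] (xs : List S) :
    RingTheory.Sequence.IsWeaklyRegular S xs ↔ RegSeq ⊥ xs := by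
  rw [regSeq_iff_getElem, RingTheory.Sequence.isWeaklyRegular_iff]
  refine forall_congr' fun i => forall_congr' fun h => ?_
  rw [regMod_iff_isSMulRegular, bot_sup_eq]
  have : (Ideal.ofList (xs.take i) • ⊤ : Submodule S S) = Ideal.ofList (xs.take i) := by simp
  rw [this]

theorem dep_of_regSeq {S : Type*} [CommRing S] [IsLocalRing S] : ∀ (xs : List S) (J : Ideal S),
    (∀ x ∈ xs, x ∈ IsLocalRing.maximalIdeal S) → RegSeq J xs → Dep xs.length J := by
  intro xs
  induction xs with
  | nil => intros; trivial
  | cons x xs ih =>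
    intro J hm h
    exact ⟨x, hm x (by simp), h.1, ih _ (fun y hy => hm y (by simp [hy])) h.2⟩

theorem exists_pow_le {S : Type*} [CommRing S] [IsLocalRing S] [IsNoetherianRing S]
    {I : Ideal S} (h : ∀ p : Ideal S, p.IsPrime → I ≤ p → p = IsLocalRing.maximalIdeal S) :
    ∃ N, IsLocalRing.maximalIdeal S ^ N ≤ I := by
  obtain ⟨N, hN⟩ := Ideal.exists_radical_pow_le_of_fg I (IsNoetherian.noetherian _)
  refine ⟨N, le_trans (Ideal.pow_right_mono ?_ N) hN⟩
  rw [Ideal.radical_eq_sInf]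
  refine le_sInf fun p hp => ?_
  rw [h p hp.2 hp.1]

theorem prime_eq_max_of_dim {S : Type*} [CommRing S] [IsLocalRing S]
    {I : Ideal S} (h : ringKrullDim (S ⧸ I) ≤ 0) (p : Ideal S) (hp : p.IsPrime) (hI : I ≤ p) :
    p = IsLocalRing.maximalIdeal S := by
  by_contra hne
  have hlt : p < IsLocalRing.maximalIdeal S :=
    lt_of_le_of_ne (IsLocalRing.le_maximalIdeal hp.ne_top) hne
  rw [ringKrullDim_quotient] at h
  let a : PrimeSpectrum.zeroLocus (R := S) I := ⟨⟨p, hp⟩, hI⟩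
  let b : PrimeSpectrum.zeroLocus (R := S) I :=
    ⟨⟨IsLocalRing.maximalIdeal S, inferInstance⟩, hI.trans hlt.le⟩
  have hab : a < b := hlt
  have hpos : 0 < Order.krullDim (PrimeSpectrum.zeroLocus (R := S) I) := by
    rw [Order.krullDim_pos_iff]
    exact ⟨a, b, hab⟩
  exact absurd h (not_le.2 hpos)

theorem core {R B L : Type*} [CommRing R] [IsLocalRing R] [IsNoetherianRing R]
    [CommRing B] [Algebra R B] [Module.Finite R B] [CommRing L] [IsLocalRing L]
    [IsNoetherianRing L] [Algebra B L] [Algebra R L] [IsScalarTower R B L]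
    (Q : Ideal B) [hQ : Q.IsMaximal] [IsLocalization.AtPrime L Q]
    (hdim : ringKrullDim L = ringKrullDim R)
    (θ : B →ₗ[R] R) (hθ : ∀ f : B →ₗ[R] R, ∃ a, ∀ x, f x = θ (a * x))
    (hR : IsGorensteinLocalRing R) (hL : IsCMLocalRing L) : IsGorensteinLocalRing L := by
  obtain ⟨xs, hxs, hreg, hlen, hinj⟩ := hR
  obtain ⟨ys, hys, hyreg, hylen⟩ := hL
  have hreg' := (isWeaklyRegular_iff_regSeq xs).1 hreg.1
  have hyreg' := (isWeaklyRegular_iff_regSeq ys).1 hyreg.1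
  have hdimq : ringKrullDim (R ⧸ Ideal.ofList xs) ≤ 0 := by
    have h := ringKrullDim_add_length_eq_ringKrullDim_of_isRegular xs hreg
    rw [← hlen] at h
    generalize ringKrullDim (R ⧸ Ideal.ofList xs) = d at h
    cases d with
    | bot => exact bot_le
    | coe e =>
      have h' : e + (xs.length : ℕ∞) = 0 + (xs.length : ℕ∞) := by
        rw [zero_add]
        exact WithBot.coe_injective h
      have h2 : e ≤ 0 := (ENat.add_le_add_iff_right (ENat.natCast_ne_top _)).1 h'.le
      exact WithBot.coe_le_coe.2 h2
  have hpR := prime_eq_max_of_dim hdimq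
  obtain ⟨N, hN⟩ := exists_pow_le hpR
  let xL := xs.map (algebraMap R L)
  have hxQ : ∀ x ∈ IsLocalRing.maximalIdeal R, algebraMap R B x ∈ Q := by
    have hmax : (Q.under R).IsMaximal := Ideal.isMaximal_comap_of_isIntegral_of_isMaximal Q
    intro x hx
    rw [← IsLocalRing.eq_maximalIdeal hmax] at hx
    exact hx
  have hxL : ∀ x ∈ xL, x ∈ IsLocalRing.maximalIdeal L := by
    intro x hx
    obtain ⟨y, hy, rfl⟩ := List.mem_map.1 hx
    rw [IsScalarTower.algebraMap_apply R B L]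
    exact (IsLocalization.AtPrime.to_map_mem_maximal_iff L Q _).2 (hxQ y (hxs y hy))
  have hpL : ∀ p : Ideal L, p.IsPrime → Ideal.ofList xL ≤ p →
      p = IsLocalRing.maximalIdeal L := by
    intro p hp hle
    have h1 : Ideal.ofList xs ≤ p.comap (algebraMap R L) := by
      rw [← Ideal.map_le_iff_le_comap, Ideal.map_ofList]
      exact hle
    have h2 := hpR _ (Ideal.comap_isPrime (algebraMap R L) p) h1
    let pB := p.comap (algebraMap B L)
    have h3 : pB.comap (algebraMap R B) = IsLocalRing.maximalIdeal R := by
      rw [← h2, Ideal.comap_comap, ← IsScalarTower.algebraMap_eq]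
    have h4 : pB.IsPrime := Ideal.comap_isPrime _ _
    have h5 : pB.IsMaximal := Ideal.IsIntegral.isMaximal_of_isMaximal_comap (R := R) pB
      (h3 ▸ inferInstance)
    have h6 : pB ≤ Q := by
      intro b hb
      rw [← IsLocalization.AtPrime.to_map_mem_maximal_iff L Q]
      exact IsLocalRing.le_maximalIdeal hp.ne_top hb
    have h7 : pB = Q := h5.eq_of_le hQ.ne_top h6
    refine le_antisymm (IsLocalRing.le_maximalIdeal hp.ne_top) ?_
    rw [← IsLocalization.AtPrime.map_eq_maximalIdeal Q L, ← h7]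
    exact Ideal.map_comap_le
  obtain ⟨N', hN'⟩ := exists_pow_le hpL
  have hll : xL.length = ys.length := by
    have : ((xL.length : ℕ∞) : WithBot ℕ∞) = ((ys.length : ℕ∞) : WithBot ℕ∞) := by
      simp only [xL, List.length_map]
      exact hlen.trans (hdim.symm.trans hylen.symm)
    exact_mod_cast this
  have hregL : RegSeq ⊥ xL := by
    refine regSeq_of_dep (N := N') hxL ?_ (by simpa using hN')
    rw [hll]
    exact dep_of_regSeq ys ⊥ hys hyreg'
  have hsoc : SocS (Ideal.ofList xL) :=
    socS_localization hxs hreg' hinj hN hxL hregL Q θ hθ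
  refine ⟨xL, hxL, RingTheory.Sequence.IsRegular.of_isWeaklyRegular_of_mem_maximalIdeal _ hxL
    ((isWeaklyRegular_iff_regSeq xL).2 hregL), ?_, ?_⟩
  · rw [hll]; exact hylen
  · refine SocS.injective (J := Ideal.ofList xL) ?_ hN' hsoc
    intro h
    have : Ideal.ofList xL ≤ IsLocalRing.maximalIdeal L := Ideal.span_le.2 hxL
    rw [h, top_le_iff] at this
    exact Ideal.IsPrime.ne_top' this

end Bridge

section Assembly

theorem theta_loc {P A R B : Type*} [CommRing P] [CommRing A] [Algebra P A]
    [IsNoetherianRing P] [Module.Finite P A] [CommRing R] [CommRing B] [Algebra P R]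
    [Algebra A B] [Algebra R B] [Algebra P B] [IsScalarTower P A B] [IsScalarTower P R B]
    (M : Submonoid P) [IsLocalization M R] [IsLocalization (Algebra.algebraMapSubmonoid A M) B]
    (θ : A →ₗ[P] P) (hθ : ∀ f : A →ₗ[P] P, ∃ a, ∀ x, f x = θ (a * x)) :
    ∃ θ' : B →ₗ[R] R, ∀ f : B →ₗ[R] R, ∃ a, ∀ x, f x = θ' (a * x) := by
  let ι : A →ₗ[P] B := (IsScalarTower.toAlgHom P A B).toLinearMap
  let κ : P →ₗ[P] R := (IsScalarTower.toAlgHom P P R).toLinearMap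
  have hι : IsLocalizedModule M ι := isLocalizedModule_iff_isLocalization.2 inferInstance
  have hκ : IsLocalizedModule M κ := isLocalizedModule_iff_isLocalization.2 inferInstance
  have : Module.FinitePresentation P A := Module.finitePresentation_of_finite P A
  let F := IsLocalizedModule.mapExtendScalars M ι κ R
  have hF : IsLocalizedModule M F := inferInstance
  have hFa : ∀ (g : A →ₗ[P] P) (x : A), F g (algebraMap A B x) = algebraMap P R (g x) := by
    intro g x
    exact IsLocalizedModule.map_apply M ι κ g x
  refine ⟨F θ, fun f => ?_⟩
  obtain ⟨⟨g, s⟩, hg⟩ := IsLocalizedModule.surj M F f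
  obtain ⟨a, ha⟩ := hθ g
  have hs : IsUnit (algebraMap P R s) := IsLocalization.map_units R s
  obtain ⟨u, hu⟩ := hs
  refine ⟨algebraMap R B ((u⁻¹ : Rˣ) : R) * algebraMap A B a, fun x => ?_⟩
  have h1 : F g = F θ ∘ₗ LinearMap.mulLeft R (algebraMap A B a) := by
    have : (F g).restrictScalars P =
        (F θ ∘ₗ LinearMap.mulLeft R (algebraMap A B a)).restrictScalars P := by
      apply IsLocalizedModule.linearMap_ext M ι κ
      ext y
      change F g (algebraMap A B y) = F θ (algebraMap A B a * algebraMap A B y)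
      rw [← map_mul, hFa, hFa, ha]
    ext y
    exact LinearMap.congr_fun this y
  have h2 : (u : R) * f x = F θ (algebraMap A B a * x) := by
    have h3 := LinearMap.congr_fun hg x
    have h4 := LinearMap.congr_fun h1 x
    simp only [LinearMap.comp_apply, LinearMap.mulLeft_apply] at h4
    rw [← h4, ← h3, hu, ← smul_eq_mul, algebraMap_smul]
    rfl
  rw [mul_assoc, ← Algebra.smul_def, map_smul, ← h2, smul_eq_mul, ← mul_assoc]
  simp

theorem assembly {k A P : Type*} [Field k] [CommRing A] [IsDomain A] [Algebra k A]
    [Algebra.FiniteType k A] [CommRing P] [Algebra P A] [Module.Finite P A]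
    (hinj : Function.Injective (algebraMap P A))
    (hPGor : ∀ (q : Ideal P) (hq : q.IsPrime),
      haveI := hq
      IsGorensteinLocalRing (Localization.AtPrime q))
    (θ : A →ₗ[P] P) (hθ : ∀ f : A →ₗ[P] P, ∃ a, ∀ x, f x = θ (a * x))
    (Q : Ideal A) [hQ : Q.IsPrime] (hCM : IsCMLocalRing (Localization.AtPrime Q)) :
    IsGorensteinLocalRing (Localization.AtPrime Q) := by
  have hA : IsNoetherianRing A := Algebra.FiniteType.isNoetherianRing k A
  have hP : IsNoetherianRing P := eakin_nagata hinj
  let q := Q.under P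
  let M := q.primeCompl
  let R := Localization.AtPrime q
  let B := Localization (Algebra.algebraMapSubmonoid A M)
  let L := Localization.AtPrime Q
  have hR : IsNoetherianRing R := IsLocalization.isNoetherianRing M R hP
  have hL : IsNoetherianRing L := IsLocalization.isNoetherianRing Q.primeCompl L hA
  have hle : Algebra.algebraMapSubmonoid A M ≤ Q.primeCompl := by
    rintro _ ⟨y, hy, rfl⟩
    exact hy
  letI : Algebra B L := IsLocalization.localizationAlgebraOfSubmonoidLe B L
    (Algebra.algebraMapSubmonoid A M) Q.primeCompl hle
  have hABL : IsScalarTower A B L :=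
    IsLocalization.localization_isScalarTower_of_submonoid_le B L _ _ hle
  letI : Algebra R L := ((algebraMap B L).comp (algebraMap R B)).toAlgebra
  have hRBL : IsScalarTower R B L := IsScalarTower.of_algebraMap_eq' rfl
  have hfin : Module.Finite R B := Module.Finite.of_isLocalization P A M
  let QB : Ideal B := (IsLocalRing.maximalIdeal L).comap (algebraMap B L)
  have hQBp : QB.IsPrime := Ideal.comap_isPrime _ _
  have hmemQ : ∀ a : A, algebraMap A B a ∈ QB ↔ a ∈ Q := by
    intro a
    change algebraMap B L (algebraMap A B a) ∈ IsLocalRing.maximalIdeal L ↔ _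
    rw [← IsScalarTower.algebraMap_apply]
    exact IsLocalization.AtPrime.to_map_mem_maximal_iff L Q a
  have hloc : IsLocalization.AtPrime L QB := by
    have h1 := IsLocalization.isLocalization_of_submonoid_le B L _ _ hle
    refine @IsLocalization.isLocalization_of_is_exists_mul_mem _ _ _ _ _ _ _ h1 ?_ ?_
    · rintro _ ⟨a, ha, rfl⟩
      exact fun h => ha ((hmemQ a).1 h)
    · rintro ⟨x, hx⟩
      obtain ⟨⟨y, s⟩, e⟩ := IsLocalization.surj (Algebra.algebraMapSubmonoid A M) x
      refine ⟨algebraMap A B s, y, ?_, ?_⟩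
      · intro hy
        have h2 : x * algebraMap A B s ∈ QB := by
          rw [e]; exact (hmemQ y).2 hy
        rcases hQBp.mem_or_mem h2 with h3 | h3
        · exact hx h3
        · exact hle s.2 ((hmemQ s).1 h3)
      · rw [← e, mul_comm]
  have hQBm : QB.IsMaximal := by
    apply Ideal.IsIntegral.isMaximal_of_isMaximal_comap (R := R) QB
    have : QB.comap (algebraMap R B) = IsLocalRing.maximalIdeal R := by
      refine le_antisymm (IsLocalRing.le_maximalIdeal (Ideal.comap_isPrime _ _).ne_top) ?_
      rw [← IsLocalization.AtPrime.map_eq_maximalIdeal q R, Ideal.map_le_iff_le_comap]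
      intro x hx
      change algebraMap R B (algebraMap P R x) ∈ QB
      rw [← IsScalarTower.algebraMap_apply, IsScalarTower.algebraMap_apply P A B]
      exact (hmemQ _).2 hx
    rw [this]
    infer_instance
  have hdim : ringKrullDim L = ringKrullDim R := by
    rw [IsLocalization.AtPrime.ringKrullDim_eq_height Q L,
      IsLocalization.AtPrime.ringKrullDim_eq_height q R,
      height_under_eq (k := k) hinj Q]
  obtain ⟨θ', hθ'⟩ := theta_loc (R := R) (B := B) M θ hθ
  exact core (R := R) (B := B) (L := L) QB hdim θ' hθ' (hPGor q inferInstance) hCM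

end Assembly

/-- **Statement 19.**  Let `P ⊆ A` be a Gorenstein subring of a finitely generated normal
algebra `A` over a field, with `A` a finite `P`-module, and suppose `A` is quasi-Gorenstein
with respect to `P`, i.e. `Hom_P(A,P) ≅ A` as `A`-modules.  Then for every prime ideal `Q`
of `A` the localization `A_Q` is Cohen-Macaulay iff it is Gorenstein: the Cohen-Macaulay
and Gorenstein loci of `A` coincide. -/
theorem quasiGorenstein_cm_iff_gorenstein
    {k : Type*} [Field k] {A : Type*} [CommRing A] [IsDomain A] [IsIntegrallyClosed A]
    [Algebra k A] [Algebra.FiniteType k A]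
    (P : Subring A)
    (hPGor : ∀ (q : Ideal ↥P) (hq : q.IsPrime),
      haveI := hq
      IsGorensteinLocalRing (Localization.AtPrime q))
    (hfin : Module.Finite ↥P A)
    (hQG : ∃ θ : A →ₗ[↥P] ↥P, ∀ f : A →ₗ[↥P] ↥P, ∃! a : A, ∀ x, f x = θ (a * x)) :
    ∀ (Q : Ideal A) (hQ : Q.IsPrime),
      haveI := hQ
      (IsCMLocalRing (Localization.AtPrime Q) ↔
        IsGorensteinLocalRing (Localization.AtPrime Q)) := by
  intro Q hQ
  constructor
  · intro hCM
    obtain ⟨θ, hθ⟩ := hQG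
    exact assembly (k := k) (P := P) Subtype.val_injective hPGor θ
      (fun f => (hθ f).exists) Q hCM
  · rintro ⟨rs, h1, h2, h3, -⟩
    exact ⟨rs, h1, h2, h3⟩

end QGor
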